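/- arXiv:2501.12225 — 5 statements merged into one kernel-verified Lean document; each statement's English description precedes it below -/
import Mathlib

section
/- Let c ≥ 0 and ρ > 0. The Ricci endomorphism of the metric Lie algebra (heis₃, g_ρ^c) is, with respect to the ordered basis (e₀, f₀, Z), given by the matrix (2ρ²(ρ+c)/(ρ+2c)³)·diag(−1, −1, 1). -/
open Matrix

/-- The three-dimensional Heisenberg bracket on `ℝ³` in the basis `(e₀, f₀, Z)`:
the only nonzero basis bracket is `[e₀,f₀] = Z`, with `Z` central. -/
def brkH (x y : Fin 3 → ℝ) : Fin 3 → ℝ :=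
  fun k => if (k:ℕ) = 2 then x 0 * y 1 - x 1 * y 0 else 0

/-- The Gram matrix of the inner product `g_ρ^c` on `heis₃` in the basis `(e₀,f₀,Z)`:
`diag((ρ+2c)/(4ρ²), (ρ+2c)/(4ρ²), (ρ+c)/(4ρ²(ρ+2c)))`. -/
noncomputable def GramH (c ρ : ℝ) : Matrix (Fin 3) (Fin 3) ℝ :=
  Matrix.diagonal ![(ρ+2*c)/(4*ρ^2), (ρ+2*c)/(4*ρ^2), (ρ+c)/(4*ρ^2*(ρ+2*c))]

/-- The matrix (in the basis `(e₀,f₀,Z)`) of the adjoint operator `ad(x) = [x,·]`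
of `heis₃`. -/
noncomputable def adH (x : Fin 3 → ℝ) : Matrix (Fin 3) (Fin 3) ℝ :=
  Matrix.of fun i j => brkH x (Pi.single j 1) i

theorem mulVec_dotProduct_diagonal_mulVec_single {n : Type*} [Fintype n] [DecidableEq n]
    (M : Matrix n n ℝ) (d : n → ℝ) (i j : n) :
    (M.mulVec (Pi.single j 1)) ⬝ᵥ (diagonal d).mulVec (Pi.single i 1) = M i j * d i := by
  simp [Matrix.mulVec_single]

theorem sum_mul_of_orthonormal_diagonal {n : Type*} [Fintype n] [DecidableEq n]
    {d : n → ℝ} {L : n → n → ℝ}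
    (hL : ∀ i j, L i ⬝ᵥ (diagonal d).mulVec (L j) = if i = j then (1 : ℝ) else 0) (k l : n) :
    d k * ∑ i, L i k * L i l = if k = l then 1 else 0 := by
  have h : Matrix.of L * (diagonal d * (Matrix.of L)ᵀ) = 1 := by
    ext i j
    rw [Matrix.one_apply, ← hL i j, Matrix.mul_apply]
    simp [dotProduct, Matrix.mulVec_diagonal, Matrix.diagonal_mul]
  have h' := congrArg (fun M : Matrix n n ℝ => M k l) (mul_eq_one_comm.mp h)
  rw [Matrix.mul_assoc, Matrix.diagonal_mul, Matrix.one_apply, Matrix.mul_apply] at h'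
  simpa using h'

theorem adH_trace (x : Fin 3 → ℝ) : (adH x).trace = 0 := by
  simp [Matrix.trace, Fin.sum_univ_three, adH, brkH]

theorem adH_mul_adH (x y : Fin 3 → ℝ) : adH x * adH y = 0 := by
  ext i j
  fin_cases i <;> simp [Matrix.mul_apply, Fin.sum_univ_three, adH, brkH]

theorem adH_zero : adH 0 = 0 := by
  ext i j
  simp [adH, brkH]

/-- for `c ≥ 0` and `ρ > 0`, the Ricci endomorphism of the metric Lie
algebra `(heis₃, g_ρ^c)` is, in the basis `(e₀,f₀,Z)`, the matrix
`(2ρ²(ρ+c)/(ρ+2c)³)·diag(-1,-1,1)`.  The Ricci endomorphism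
`ric = R - (1/2)B - (1/2)(ad H + (ad H)*)` is transcribed through matrices in the basis
`(e₀,f₀,Z)`: `L` is an orthonormal basis for `g_ρ^c`, `H` is the mean curvature vector,
`B` the Killing operator, `R` the curvature operator and `adHs` the metric adjoint of
`ad H`, each characterized by its defining property. -/
theorem statement11 (c ρ : ℝ) (hc : 0 ≤ c) (hρ : 0 < ρ)
    (L : Fin 3 → (Fin 3 → ℝ))
    (hL : ∀ i j, L i ⬝ᵥ (GramH c ρ).mulVec (L j) = if i = j then (1:ℝ) else 0)
    (H : Fin 3 → ℝ)
    (hH : ∀ x, H ⬝ᵥ (GramH c ρ).mulVec x = (adH x).trace)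
    (Bm : Matrix (Fin 3) (Fin 3) ℝ)
    (hB : ∀ x y, (Bm.mulVec x) ⬝ᵥ (GramH c ρ).mulVec y = (adH x * adH y).trace)
    (Rm : Matrix (Fin 3) (Fin 3) ℝ)
    (hR : ∀ x y, (Rm.mulVec x) ⬝ᵥ (GramH c ρ).mulVec y =
      -(1/2) * (∑ i, (brkH x (L i)) ⬝ᵥ (GramH c ρ).mulVec (brkH y (L i)))
      + (1/4) * (∑ i, ∑ j,
          ((brkH (L i) (L j)) ⬝ᵥ (GramH c ρ).mulVec x)
            * ((brkH (L i) (L j)) ⬝ᵥ (GramH c ρ).mulVec y)))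
    (adHs : Matrix (Fin 3) (Fin 3) ℝ)
    (hadHs : ∀ x y, ((adH H).mulVec x) ⬝ᵥ (GramH c ρ).mulVec y
      = x ⬝ᵥ (GramH c ρ).mulVec (adHs.mulVec y)) :
    Rm - (1/2 : ℝ) • Bm - (1/2 : ℝ) • (adH H + adHs)
      = (2*ρ^2*(ρ+c)/(ρ+2*c)^3) • Matrix.diagonal ![-1, -1, 1] := by
  obtain ⟨a, ha⟩ : ∃ a, a = (ρ+2*c)/(4*ρ^2) := ⟨_, rfl⟩
  obtain ⟨b, hb⟩ : ∃ b, b = (ρ+c)/(4*ρ^2*(ρ+2*c)) := ⟨_, rfl⟩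
  have hG : GramH c ρ = diagonal ![a, a, b] := by rw [GramH, ha, hb]
  have ha0 : a ≠ 0 := by rw [ha]; positivity
  have hb0 : b ≠ 0 := by rw [hb]; positivity
  have hd : ∀ i, ![a, a, b] i ≠ 0 := by
    intro i; fin_cases i <;> simp [ha0, hb0]
  have hscal : 2*ρ^2*(ρ+c)/(ρ+2*c)^3 = b / (2 * a^2) := by
    have : ρ + 2*c ≠ 0 := by positivity
    rw [ha, hb]; field_simp; ring
  rw [hG] at hL hH hB hR hadHs
  have hH0 : H = 0 := by
    ext i
    have h := hH (Pi.single i 1)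
    rw [adH_trace] at h
    simpa [hd i] using h
  have hB0 : Bm = 0 := by
    ext i j
    have h := hB (Pi.single j 1) (Pi.single i 1)
    rw [mulVec_dotProduct_diagonal_mulVec_single, adH_mul_adH] at h
    simpa [hd i] using h
  have hA0 : adHs = 0 := by
    ext i j
    have h := hadHs (Pi.single i 1) (Pi.single j 1)
    rw [hH0, adH_zero] at h
    simpa [Matrix.mulVec_diagonal, hd i] using h
  have hS := sum_mul_of_orthonormal_diagonal hL
  have h00 : ∑ i, L i 0 * L i 0 = 1 / a := by
    rw [eq_div_iff ha0, mul_comm]; simpa using hS 0 0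
  have h11 : ∑ i, L i 1 * L i 1 = 1 / a := by
    rw [eq_div_iff ha0, mul_comm]; simpa using hS 1 1
  have h01 : ∑ i, L i 0 * L i 1 = 0 := by simpa [ha0] using hS 0 1
  simp only [Fin.sum_univ_three] at h00 h11 h01
  have hcancel : b / (2 * a^2) * a = b / 2 * (1 / a) := by field_simp
  have hRm : Rm = (b / (2 * a^2)) • diagonal ![-1, -1, 1] := by
    ext i j
    apply mul_right_cancel₀ (hd i)
    rw [← mulVec_dotProduct_diagonal_mulVec_single, hR]
    fin_cases i <;> fin_cases j <;>
      simp [brkH, dotProduct, Matrix.mulVec_diagonal, Fin.sum_univ_three]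
    · linear_combination b / 2 * h11 - hcancel
    · linear_combination -b * h01
    · linear_combination -b * h01
    · linear_combination b / 2 * h00 - hcancel
    · linear_combination b ^ 2 / 2 * ((L 0 1 * L 0 1 + L 1 1 * L 1 1 + L 2 1 * L 2 1) * h00
        + 1 / a * h11 - (L 0 0 * L 0 1 + L 1 0 * L 1 1 + L 2 0 * L 2 1) * h01)
  rw [hH0, hB0, hA0, adH_zero, hRm, hscal]
  simp
end

section
/- Let n ≥ 2, c ≥ 0 and ρ > 0. The Ricci endomorphism of the metric Lie algebra (𝔩, g_ρ^c) is, with respect to the ordered basis 𝓑_n, given by the matrix diag(r₁·1_{2n−2}, r₃·1₂, r₄·1_{2n−2}, r₂) + 2c(r₁ − r₂)·E_{4n−1,2}, where r₁, r₂, r₃, r₄ are the stated rational functions of ρ, c, n. -/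
open Matrix

/-- Coordinate access with a natural-number index (zero outside range). -/
noncomputable def nth {m : ℕ} (x : Fin m → ℝ) (j : ℕ) : ℝ := if h : j < m then x ⟨j, h⟩ else 0

/-- The Lie bracket of `𝔩 = 𝔟 ⋉ heis_{2(n+2)+1}` in coordinates with respect to the
ordered basis `𝓑 = (B₁ᴿ, B₁ᴵ, …, B_{n+1}ᴿ, B_{n+1}ᴵ, e₀, f₀, …, e_{n+1}, f_{n+1}, Z)`
(the paper's `n` is our `n+2`, so `dim 𝔩 = 4n+7`).  The structure constants encode:
`[B₁ᴿ,B₁ᴵ] = 2B₁ᴵ`, `[B₁ᴿ,B_aᴿ] = B_aᴿ`, `[B₁ᴿ,B_aᴵ] = B_aᴵ`, `[B_aᴿ,B_aᴵ] = (1/2)B₁ᴵ`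
(`a ≥ 2`) in `𝔟`; the action of `𝔟` on the Heisenberg part by `[B,v] = -(Bᵀ)_ℝ v`
(equivalently the real form of the brackets `[B₁ᴿ,E_k] = -δ_{k0}E_1 - δ_{k1}E_0`,
`[B_aᴿ,E_k] = -(1/2)(δ_{k0}+δ_{k1})E_a - (1/2)δ_{ka}(E_0-E_1)`,
`[B₁ᴵ,E_k] = -i(δ_{k0}+δ_{k1})(E_0-E_1)`,
`[B_aᴵ,E_k] = (i/2)(δ_{k0}+δ_{k1})E_a - (i/2)δ_{ka}(E_0-E_1)` for `E_k = e_k - i f_k`);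
and the Heisenberg brackets `[e₀,f₀] = Z`, `[e_a,f_a] = -Z` (`a ≥ 1`). -/
noncomputable def brkL (n : ℕ) (x y : Fin (4*n+7) → ℝ) : Fin (4*n+7) → ℝ := fun k =>
  let X := nth x; let Y := nth y
  let K := (k : ℕ)
  if K = 0 then 0
  else if K = 1 then
    2*(X 0 * Y 1 - X 1 * Y 0)
      + (1/2) * ∑ t ∈ Finset.range n, (X (2*t+2) * Y (2*t+3) - X (2*t+3) * Y (2*t+2))
  else if K < 2*n+2 then X 0 * Y K - X K * Y 0
  else if K = 2*n+2 then
    -(X 0 * Y (2*n+4) - X (2*n+4) * Y 0)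
    + (X 1 * (Y (2*n+3) + Y (2*n+5)) - (X (2*n+3) + X (2*n+5)) * Y 1)
    - (1/2) * ∑ t ∈ Finset.range n, (X (2*t+2) * Y (2*n+6+2*t) - X (2*n+6+2*t) * Y (2*t+2))
    + (1/2) * ∑ t ∈ Finset.range n, (X (2*t+3) * Y (2*n+7+2*t) - X (2*n+7+2*t) * Y (2*t+3))
  else if K = 2*n+3 then
    -(X 0 * Y (2*n+5) - X (2*n+5) * Y 0)
    - (X 1 * (Y (2*n+2) + Y (2*n+4)) - (X (2*n+2) + X (2*n+4)) * Y 1)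
    - (1/2) * ∑ t ∈ Finset.range n, (X (2*t+2) * Y (2*n+7+2*t) - X (2*n+7+2*t) * Y (2*t+2))
    - (1/2) * ∑ t ∈ Finset.range n, (X (2*t+3) * Y (2*n+6+2*t) - X (2*n+6+2*t) * Y (2*t+3))
  else if K = 2*n+4 then
    -(X 0 * Y (2*n+2) - X (2*n+2) * Y 0)
    - (X 1 * (Y (2*n+3) + Y (2*n+5)) - (X (2*n+3) + X (2*n+5)) * Y 1)
    + (1/2) * ∑ t ∈ Finset.range n, (X (2*t+2) * Y (2*n+6+2*t) - X (2*n+6+2*t) * Y (2*t+2))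
    - (1/2) * ∑ t ∈ Finset.range n, (X (2*t+3) * Y (2*n+7+2*t) - X (2*n+7+2*t) * Y (2*t+3))
  else if K = 2*n+5 then
    -(X 0 * Y (2*n+3) - X (2*n+3) * Y 0)
    + (X 1 * (Y (2*n+2) + Y (2*n+4)) - (X (2*n+2) + X (2*n+4)) * Y 1)
    + (1/2) * ∑ t ∈ Finset.range n, (X (2*t+2) * Y (2*n+7+2*t) - X (2*n+7+2*t) * Y (2*t+2))
    + (1/2) * ∑ t ∈ Finset.range n, (X (2*t+3) * Y (2*n+6+2*t) - X (2*n+6+2*t) * Y (2*t+3))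
  else if K = 4*n+6 then
    (X (2*n+2) * Y (2*n+3) - X (2*n+3) * Y (2*n+2))
      - ∑ t ∈ Finset.range (n+1),
          (X (2*n+4+2*t) * Y (2*n+5+2*t) - X (2*n+5+2*t) * Y (2*n+4+2*t))
  else if K % 2 = 0 then
    -(1/2) * (X (K-2*n-4) * (Y (2*n+2) + Y (2*n+4)) - (X (2*n+2) + X (2*n+4)) * Y (K-2*n-4))
    - (1/2) * (X (K-2*n-3) * (Y (2*n+3) + Y (2*n+5)) - (X (2*n+3) + X (2*n+5)) * Y (K-2*n-3))
  else
    -(1/2) * (X (K-2*n-5) * (Y (2*n+3) + Y (2*n+5)) - (X (2*n+3) + X (2*n+5)) * Y (K-2*n-5))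
    + (1/2) * (X (K-2*n-4) * (Y (2*n+2) + Y (2*n+4)) - (X (2*n+2) + X (2*n+4)) * Y (K-2*n-4))

/-- The Gram matrix of the inner product `g_ρ^c` on `𝔩` in the ordered basis `𝓑`. -/
noncomputable def GramL (n : ℕ) (c ρ : ℝ) : Matrix (Fin (4*n+7)) (Fin (4*n+7)) ℝ :=
  Matrix.of fun i j =>
    if i = j then
      (if (i:ℕ) = 0 then (ρ+c)/ρ
       else if (i:ℕ) = 1 then (ρ+c)^3/(ρ^2*(ρ+2*c))
       else if (i:ℕ) < 2*n+2 then (ρ+c)/(4*ρ)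
       else if (i:ℕ) < 2*n+4 then (ρ+2*c)/(4*ρ^2)
       else if (i:ℕ) < 4*n+6 then 1/(4*ρ)
       else (ρ+c)/(4*ρ^2*(ρ+2*c)))
    else if ((i:ℕ) = 1 ∧ (j:ℕ) = 4*n+6) ∨ ((i:ℕ) = 4*n+6 ∧ (j:ℕ) = 1) then
      -(c*(ρ+c))/(2*ρ^2*(ρ+2*c))
    else 0

/-- The matrix, in the ordered basis `𝓑`, of the adjoint operator `ad(x) = [x,·]` of `𝔩`. -/
noncomputable def adL (n : ℕ) (x : Fin (4*n+7) → ℝ) : Matrix (Fin (4*n+7)) (Fin (4*n+7)) ℝ :=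
  Matrix.of fun i j => brkL n x (Pi.single j 1) i

/-- Names of the elements of the ordered basis `𝓑`. -/
inductive BasisName (n : ℕ)
  | a | b | e₀ | f₀ | e₁ | f₁ | z
  | u (t : Fin n) | v (t : Fin n) | e (t : Fin n) | f (t : Fin n)
  deriving DecidableEq

namespace BasisName

variable {n : ℕ}

/-- The position of a named basis element in the ordered basis `𝓑`. -/
def pos : BasisName n → Fin (4*n+7)
  | a => ⟨0, by omega⟩
  | b => ⟨1, by omega⟩
  | e₀ => ⟨2*n+2, by omega⟩
  | f₀ => ⟨2*n+3, by omega⟩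
  | e₁ => ⟨2*n+4, by omega⟩
  | f₁ => ⟨2*n+5, by omega⟩
  | z => ⟨4*n+6, by omega⟩
  | u t => ⟨2*t+2, by omega⟩
  | v t => ⟨2*t+3, by omega⟩
  | e t => ⟨2*n+6+2*t, by omega⟩
  | f t => ⟨2*n+7+2*t, by omega⟩

theorem pos_injective : Function.Injective (pos : BasisName n → Fin (4*n+7)) := by
  intro i j h
  cases i <;> cases j <;> simp [pos, Fin.ext_iff] at h ⊢ <;> omega

@[simp]
theorem pos_inj {i j : BasisName n} : i.pos = j.pos ↔ i = j := pos_injective.eq_iff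

theorem sum_range_two_mul (m : ℕ) (f : ℕ → ℝ) :
    ∑ k ∈ Finset.range (2*m), f k = ∑ t ∈ Finset.range m, (f (2*t) + f (2*t+1)) := by
  induction m with
  | zero => simp
  | succ m ih => rw [Finset.sum_range_succ, ← ih, mul_add_one, Finset.sum_range_succ,
      Finset.sum_range_succ, add_assoc]

/-- Summation over `𝓑`, organised by the names of the basis elements. -/
theorem sum_eq (F : Fin (4*n+7) → ℝ) :
    ∑ k, F k = F (a : BasisName n).pos + F (b : BasisName n).pos + F (e₀ : BasisName n).pos
      + F (f₀ : BasisName n).pos + F (e₁ : BasisName n).pos + F (f₁ : BasisName n).pos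
      + F (z : BasisName n).pos
      + ∑ t : Fin n, (F (u t).pos + F (v t).pos + F (e t).pos + F (f t).pos) := by
  have key : ∀ G : ℕ → ℝ, ∑ k ∈ Finset.range (4*n+7), G k =
      G 0 + G 1 + G (2*n+2) + G (2*n+3) + G (2*n+4) + G (2*n+5) + G (4*n+6)
      + ∑ t ∈ Finset.range n,
        (G (2*t+2) + G (2*t+3) + G (2*n+6+2*t) + G (2*n+7+2*t)) := by
    intro G
    have h : 4*n+7 = 2 + 2*n + 4 + 2*n + 1 := by ring
    rw [h]
    simp only [Finset.sum_range_add, sum_range_two_mul, Finset.sum_add_distrib,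
      Finset.sum_range_succ, Finset.sum_range_zero]
    ring_nf
  have h := key fun k => if h : k < 4*n+7 then F ⟨k, h⟩ else 0
  rw [Finset.sum_range, Finset.sum_range] at h
  have h1 : ∀ k : Fin (4*n+7), (if h : (k:ℕ) < 4*n+7 then F ⟨k, h⟩ else 0) = F k := by
    intro k; simp
  simp only [h1] at h
  rw [h]
  have h2 : ∀ i : BasisName n,
      (if h : (i.pos : ℕ) < 4*n+7 then F ⟨i.pos, h⟩ else 0) = F i.pos := by
    intro k; simp
  congr 1
  · exact congrArg₂ _ (congrArg₂ _ (congrArg₂ _ (congrArg₂ _ (congrArg₂ _ (congrArg₂ _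
      (h2 a) (h2 b)) (h2 e₀)) (h2 f₀)) (h2 e₁)) (h2 f₁)) (h2 z)
  · refine Finset.sum_congr rfl fun t _ => ?_
    exact congrArg₂ _ (congrArg₂ _ (congrArg₂ _ (h2 (u t)) (h2 (v t))) (h2 (e t))) (h2 (f t))

theorem exists_pos_eq (k : Fin (4*n+7)) : ∃ i : BasisName n, i.pos = k := by
  by_contra! h
  have := sum_eq (n := n) fun j => if j = k then (1:ℝ) else 0
  simp [h] at this

end BasisName

open BasisName

section bracket

variable {n : ℕ} (x y : Fin (4*n+7) → ℝ)

theorem nth_pos (i : BasisName n) : nth x (i.pos : ℕ) = x i.pos := by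
  simp [nth]

/-- The exterior product of two coordinates. -/
def wedge (x y : Fin (4*n+7) → ℝ) (i j : BasisName n) : ℝ :=
  x i.pos * y j.pos - x j.pos * y i.pos

theorem nth_a : nth x 0 = x (a : BasisName n).pos := nth_pos x a
theorem nth_b : nth x 1 = x (b : BasisName n).pos := nth_pos x b
theorem nth_e₀ : nth x (2*n+2) = x (e₀ : BasisName n).pos := nth_pos x e₀
theorem nth_f₀ : nth x (2*n+3) = x (f₀ : BasisName n).pos := nth_pos x f₀
theorem nth_e₁ : nth x (2*n+4) = x (e₁ : BasisName n).pos := nth_pos x e₁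
theorem nth_f₁ : nth x (2*n+5) = x (f₁ : BasisName n).pos := nth_pos x f₁
theorem nth_u (t : Fin n) : nth x (2*t+2) = x (u t).pos := nth_pos x (u t)
theorem nth_v (t : Fin n) : nth x (2*t+3) = x (v t).pos := nth_pos x (v t)
theorem nth_e (t : Fin n) : nth x (2*n+6+2*t) = x (e t).pos := nth_pos x (e t)
theorem nth_f (t : Fin n) : nth x (2*n+7+2*t) = x (f t).pos := nth_pos x (f t)

theorem brkL_a : brkL n x y (a : BasisName n).pos = 0 := by
  simp [brkL, pos]

theorem brkL_b : brkL n x y (b : BasisName n).pos =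
    2 * wedge x y a b + (1/2) * ∑ t, wedge x y (u t) (v t) := by
  simp [brkL, Finset.sum_range, pos, wedge, nth_u, nth_v, nth_a, nth_b]

theorem brkL_u (s : Fin n) : brkL n x y (u s).pos = wedge x y a (u s) := by
  have h1 : ((u s).pos : ℕ) ≠ 0 := by simp [pos]
  have h2 : ((u s).pos : ℕ) ≠ 1 := by simp [pos]
  have h3 : ((u s).pos : ℕ) < 2*n+2 := by simp [pos]
  simp only [brkL, if_neg h1, if_neg h2, if_pos h3, nth_pos, nth_a, wedge]

theorem brkL_v (s : Fin n) : brkL n x y (v s).pos = wedge x y a (v s) := by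
  have h1 : ((v s).pos : ℕ) ≠ 0 := by simp [pos]
  have h2 : ((v s).pos : ℕ) ≠ 1 := by simp [pos]
  have h3 : ((v s).pos : ℕ) < 2*n+2 := by simp only [pos]; omega
  simp only [brkL, if_neg h1, if_neg h2, if_pos h3, nth_pos, nth_a, wedge]

theorem brkL_e₀ : brkL n x y (e₀ : BasisName n).pos =
    -wedge x y a e₁ + wedge x y b f₀ + wedge x y b f₁
    + (1/2) * ∑ t, (wedge x y (v t) (f t) - wedge x y (u t) (e t)) := by
  simp only [brkL, pos, Finset.sum_range]
  simp only [nth_u, nth_v, nth_e, nth_f, nth_a, nth_b, nth_e₀, nth_f₀, nth_e₁, nth_f₁]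
  simp only [lt_irrefl, if_false, if_true, Nat.add_eq_zero_iff, OfNat.ofNat_ne_zero, and_false,
    Nat.reduceEqDiff, show ¬ (2*n+2 = 1) by omega, Finset.sum_sub_distrib, wedge]
  ring

theorem brkL_f₀ : brkL n x y (f₀ : BasisName n).pos =
    -wedge x y a f₁ - wedge x y b e₀ - wedge x y b e₁
    - (1/2) * ∑ t, (wedge x y (u t) (f t) + wedge x y (v t) (e t)) := by
  simp only [brkL, pos, Finset.sum_range]
  simp only [nth_u, nth_v, nth_e, nth_f, nth_a, nth_b, nth_e₀, nth_f₀, nth_e₁, nth_f₁]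
  simp only [if_false, if_true, show ¬ (2*n+3 = 0) by omega, show ¬ (2*n+3 = 1) by omega,
    show ¬ (2*n+3 < 2*n+2) by omega, show ¬ (2*n+3 = 2*n+2) by omega,
    Finset.sum_sub_distrib, Finset.sum_add_distrib, wedge]
  ring

theorem brkL_e₁ : brkL n x y (e₁ : BasisName n).pos =
    -wedge x y a e₀ - wedge x y b f₀ - wedge x y b f₁
    + (1/2) * ∑ t, (wedge x y (u t) (e t) - wedge x y (v t) (f t)) := by
  simp only [brkL, pos, Finset.sum_range]
  simp only [nth_u, nth_v, nth_e, nth_f, nth_a, nth_b, nth_e₀, nth_f₀, nth_e₁, nth_f₁]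
  simp only [if_false, if_true, show ¬ (2*n+4 = 0) by omega, show ¬ (2*n+4 = 1) by omega,
    show ¬ (2*n+4 < 2*n+2) by omega, show ¬ (2*n+4 = 2*n+2) by omega,
    show ¬ (2*n+4 = 2*n+3) by omega,
    Finset.sum_sub_distrib, wedge]
  ring

theorem brkL_f₁ : brkL n x y (f₁ : BasisName n).pos =
    -wedge x y a f₀ + wedge x y b e₀ + wedge x y b e₁
    + (1/2) * ∑ t, (wedge x y (u t) (f t) + wedge x y (v t) (e t)) := by
  simp only [brkL, pos, Finset.sum_range]
  simp only [nth_u, nth_v, nth_e, nth_f, nth_a, nth_b, nth_e₀, nth_f₀, nth_e₁, nth_f₁]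
  simp only [if_false, if_true, show ¬ (2*n+5 = 0) by omega, show ¬ (2*n+5 = 1) by omega,
    show ¬ (2*n+5 < 2*n+2) by omega, show ¬ (2*n+5 = 2*n+2) by omega,
    show ¬ (2*n+5 = 2*n+3) by omega, show ¬ (2*n+5 = 2*n+4) by omega,
    Finset.sum_sub_distrib, Finset.sum_add_distrib, wedge]
  ring

theorem brkL_z : brkL n x y (z : BasisName n).pos =
    wedge x y e₀ f₀ - wedge x y e₁ f₁ - ∑ t, wedge x y (e t) (f t) := by
  simp only [brkL, pos]
  simp only [if_false, if_true, show ¬ (4*n+6 = 0) by omega, show ¬ (4*n+6 = 1) by omega,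
    show ¬ (4*n+6 < 2*n+2) by omega, show ¬ (4*n+6 = 2*n+2) by omega,
    show ¬ (4*n+6 = 2*n+3) by omega, show ¬ (4*n+6 = 2*n+4) by omega,
    show ¬ (4*n+6 = 2*n+5) by omega, Finset.sum_range_succ']
  have h1 : ∀ k, 2*n+4+2*(k+1) = 2*n+6+2*k := by intro k; ring
  have h2 : ∀ k, 2*n+5+2*(k+1) = 2*n+7+2*k := by intro k; ring
  simp only [h1, h2, mul_zero, add_zero, Finset.sum_range, nth_e, nth_f, nth_e₀, nth_f₀, nth_e₁,
    nth_f₁, wedge]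
  ring

theorem brkL_e (s : Fin n) : brkL n x y (e s).pos =
    -(1/2) * (wedge x y (u s) e₀ + wedge x y (u s) e₁ + wedge x y (v s) f₀
      + wedge x y (v s) f₁) := by
  have hs := s.2
  simp only [brkL, pos]
  simp only [if_false, if_true, show ¬ (2*n+6+2*(s:ℕ) = 0) by omega,
    show ¬ (2*n+6+2*(s:ℕ) = 1) by omega,
    show ¬ (2*n+6+2*(s:ℕ) < 2*n+2) by omega, show ¬ (2*n+6+2*(s:ℕ) = 2*n+2) by omega,
    show ¬ (2*n+6+2*(s:ℕ) = 2*n+3) by omega, show ¬ (2*n+6+2*(s:ℕ) = 2*n+4) by omega,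
    show ¬ (2*n+6+2*(s:ℕ) = 2*n+5) by omega, show ¬ (2*n+6+2*(s:ℕ) = 4*n+6) by omega,
    show (2*n+6+2*(s:ℕ)) % 2 = 0 by omega, show 2*n+6+2*(s:ℕ)-2*n-4 = 2*s+2 by omega,
    show 2*n+6+2*(s:ℕ)-2*n-3 = 2*s+3 by omega, nth_u, nth_v, nth_e₀,
    nth_f₀, nth_e₁, nth_f₁, wedge]
  ring

theorem brkL_f (s : Fin n) : brkL n x y (f s).pos =
    (1/2) * (wedge x y (v s) e₀ + wedge x y (v s) e₁ - wedge x y (u s) f₀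
      - wedge x y (u s) f₁) := by
  have hs := s.2
  simp only [brkL, pos]
  simp only [if_false, show ¬ (2*n+7+2*(s:ℕ) = 0) by omega,
    show ¬ (2*n+7+2*(s:ℕ) = 1) by omega,
    show ¬ (2*n+7+2*(s:ℕ) < 2*n+2) by omega, show ¬ (2*n+7+2*(s:ℕ) = 2*n+2) by omega,
    show ¬ (2*n+7+2*(s:ℕ) = 2*n+3) by omega, show ¬ (2*n+7+2*(s:ℕ) = 2*n+4) by omega,
    show ¬ (2*n+7+2*(s:ℕ) = 2*n+5) by omega, show ¬ (2*n+7+2*(s:ℕ) = 4*n+6) by omega,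
    show ¬ ((2*n+7+2*(s:ℕ)) % 2 = 0) by omega, show 2*n+7+2*(s:ℕ)-2*n-5 = 2*s+2 by omega,
    show 2*n+7+2*(s:ℕ)-2*n-4 = 2*s+3 by omega, nth_u, nth_v, nth_e₀,
    nth_f₀, nth_e₁, nth_f₁, wedge]
  ring

theorem wedge_swap (i j : BasisName n) : wedge y x i j = -wedge x y i j := by
  simp only [wedge]; ring

theorem wedge_add (y' : Fin (4*n+7) → ℝ) (i j : BasisName n) :
    wedge x (y + y') i j = wedge x y i j + wedge x y' i j := by
  simp only [wedge, Pi.add_apply]; ring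

theorem wedge_smul (r : ℝ) (i j : BasisName n) :
    wedge x (r • y) i j = r * wedge x y i j := by
  simp only [wedge, Pi.smul_apply, smul_eq_mul]; ring

theorem brkL_swap : brkL n y x = -brkL n x y := by
  funext k
  obtain ⟨i, rfl⟩ := exists_pos_eq k
  rw [Pi.neg_apply]
  cases i <;> simp only [brkL_a, brkL_b, brkL_e₀, brkL_f₀, brkL_e₁, brkL_f₁, brkL_z, brkL_u,
    brkL_v, brkL_e, brkL_f, wedge_swap x y, Finset.sum_neg_distrib, Finset.sum_add_distrib,
    Finset.sum_sub_distrib] <;> ring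

theorem brkL_add (y' : Fin (4*n+7) → ℝ) : brkL n x (y + y') = brkL n x y + brkL n x y' := by
  funext k
  obtain ⟨i, rfl⟩ := exists_pos_eq k
  rw [Pi.add_apply]
  cases i <;> simp only [brkL_a, brkL_b, brkL_e₀, brkL_f₀, brkL_e₁, brkL_f₁, brkL_z, brkL_u,
    brkL_v, brkL_e, brkL_f, wedge_add, Finset.sum_add_distrib,
    Finset.sum_sub_distrib] <;> ring

theorem brkL_smul (r : ℝ) : brkL n x (r • y) = r • brkL n x y := by
  funext k
  obtain ⟨i, rfl⟩ := exists_pos_eq k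
  rw [Pi.smul_apply, smul_eq_mul]
  cases i <;> simp only [brkL_a, brkL_b, brkL_e₀, brkL_f₀, brkL_e₁, brkL_f₁, brkL_z, brkL_u,
    brkL_v, brkL_e, brkL_f, wedge_smul, Finset.sum_add_distrib, ← Finset.mul_sum,
    Finset.sum_sub_distrib] <;> ring

end bracket

/-- The Lie bracket of `𝔩` as a bilinear map. -/
noncomputable def bracket (n : ℕ) :
    (Fin (4*n+7) → ℝ) →ₗ[ℝ] (Fin (4*n+7) → ℝ) →ₗ[ℝ] (Fin (4*n+7) → ℝ) :=
  LinearMap.mk₂ ℝ (brkL n)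
    (fun x x' y => by
      rw [brkL_swap y, brkL_add, brkL_swap x y, brkL_swap x' y, neg_add, neg_neg, neg_neg])
    (fun r x y => by rw [brkL_swap y, brkL_smul, brkL_swap x y, smul_neg, neg_neg])
    brkL_add (fun r x y => brkL_smul x y r)

@[simp]
theorem bracket_apply (n : ℕ) (x y : Fin (4*n+7) → ℝ) : bracket n x y = brkL n x y := rfl

theorem adL_eq_toMatrix' (n : ℕ) (x : Fin (4*n+7) → ℝ) :
    adL n x = LinearMap.toMatrix' (bracket n x) := by
  ext i j
  simp [adL, LinearMap.toMatrix'_apply]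

theorem adL_mulVec (n : ℕ) (x y : Fin (4*n+7) → ℝ) : (adL n x).mulVec y = brkL n x y := by
  rw [adL_eq_toMatrix', LinearMap.toMatrix'_mulVec, bracket_apply]

/-- The inner product `g_ρ^c` on `𝔩`. -/
noncomputable def metric (n : ℕ) (c ρ : ℝ) (x y : Fin (4*n+7) → ℝ) : ℝ :=
  x ⬝ᵥ (GramL n c ρ).mulVec y

/-- The diagonal of the Gram matrix. -/
noncomputable def gramDiag (c ρ : ℝ) {n : ℕ} : BasisName n → ℝ
  | a => (ρ+c)/ρ
  | b => (ρ+c)^3/(ρ^2*(ρ+2*c))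
  | u _ | v _ => (ρ+c)/(4*ρ)
  | e₀ | f₀ => (ρ+2*c)/(4*ρ^2)
  | e₁ | f₁ | e _ | f _ => 1/(4*ρ)
  | z => (ρ+c)/(4*ρ^2*(ρ+2*c))

theorem GramL_pos (n : ℕ) (c ρ : ℝ) (i j : BasisName n) :
    GramL n c ρ i.pos j.pos = if i = j then gramDiag c ρ i
      else if (i = b ∧ j = z) ∨ (i = z ∧ j = b) then -(c*(ρ+c))/(2*ρ^2*(ρ+2*c)) else 0 := by
  have hb : ∀ k : BasisName n, (k.pos : ℕ) = 1 ↔ k = b := fun k => by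
    rw [← pos_inj, Fin.ext_iff]; rfl
  have hz : ∀ k : BasisName n, (k.pos : ℕ) = 4*n+6 ↔ k = z := fun k => by
    rw [← pos_inj, Fin.ext_iff]; rfl
  simp only [GramL, Matrix.of_apply, pos_inj, hz, hb]
  refine if_congr Iff.rfl ?_ rfl
  cases i <;> simp only [pos, gramDiag, reduceCtorEq, if_true, if_false] <;>
    grind

theorem metric_eq {n : ℕ} {c ρ : ℝ} (hc : 0 ≤ c) (hρ : 0 < ρ) (x y : Fin (4*n+7) → ℝ) :
    metric n c ρ x y =
      (ρ+c)/ρ * (x (a : BasisName n).pos * y (a : BasisName n).pos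
        + x (b : BasisName n).pos * y (b : BasisName n).pos)
      + (ρ+c)/(4*ρ) * ∑ t : Fin n, (x (u t).pos * y (u t).pos + x (v t).pos * y (v t).pos)
      + (ρ+2*c)/(4*ρ^2) * (x (e₀ : BasisName n).pos * y (e₀ : BasisName n).pos
        + x (f₀ : BasisName n).pos * y (f₀ : BasisName n).pos)
      + 1/(4*ρ) * (x (e₁ : BasisName n).pos * y (e₁ : BasisName n).pos
        + x (f₁ : BasisName n).pos * y (f₁ : BasisName n).pos
        + ∑ t : Fin n, (x (e t).pos * y (e t).pos + x (f t).pos * y (f t).pos))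
      + (ρ+c)/(4*ρ^2*(ρ+2*c)) * ((x (z : BasisName n).pos - 2*c*x (b : BasisName n).pos)
        * (y (z : BasisName n).pos - 2*c*y (b : BasisName n).pos)) := by
  have h1 : ρ + 2*c ≠ 0 := by positivity
  simp only [metric, dotProduct, Matrix.mulVec, sum_eq, GramL_pos, reduceCtorEq, if_false, if_true,
    false_and, and_false, and_self, or_false, or_true, zero_mul, add_zero, zero_add,
    BasisName.u.injEq, BasisName.v.injEq, BasisName.e.injEq, BasisName.f.injEq, ite_mul,
    Finset.sum_const_zero, Finset.sum_add_distrib, Finset.sum_ite_eq, Finset.mem_univ,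
    ← Finset.mul_sum, gramDiag, mul_left_comm (x _)]
  field_simp
  ring

theorem GramL_isSymm (n : ℕ) (c ρ : ℝ) : (GramL n c ρ).IsSymm := by
  ext i j
  obtain ⟨i, rfl⟩ := exists_pos_eq i
  obtain ⟨j, rfl⟩ := exists_pos_eq j
  rw [Matrix.transpose_apply, GramL_pos, GramL_pos]
  cases i <;> cases j <;> simp [eq_comm, gramDiag]

theorem metric_comm (n : ℕ) (c ρ : ℝ) (x y : Fin (4*n+7) → ℝ) :
    metric n c ρ x y = metric n c ρ y x := by
  rw [metric, metric, dotProduct_mulVec, ← mulVec_transpose, GramL_isSymm, dotProduct_comm]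

/-- The inner product `g_ρ^c` as a bilinear map. -/
noncomputable def metricForm (n : ℕ) (c ρ : ℝ) :
    (Fin (4*n+7) → ℝ) →ₗ[ℝ] (Fin (4*n+7) → ℝ) →ₗ[ℝ] ℝ :=
  LinearMap.mk₂ ℝ (metric n c ρ)
    (fun x x' y => by simp [metric, add_dotProduct])
    (fun r x y => by simp [metric])
    (fun x y y' => by simp [metric, mulVec_add])
    (fun r x y => by simp [metric, mulVec_smul])

@[simp]
theorem metricForm_apply (n : ℕ) (c ρ : ℝ) (x y : Fin (4*n+7) → ℝ) :
    metricForm n c ρ x y = metric n c ρ x y := rfl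

/-- The standard basis vector with a given name. -/
noncomputable def stdVec {n : ℕ} (i : BasisName n) : Fin (4*n+7) → ℝ := Pi.single i.pos 1

theorem stdVec_pos {n : ℕ} (i j : BasisName n) : stdVec i j.pos = if j = i then 1 else 0 := by
  simp [stdVec, Pi.single_apply]

theorem trace_adL (n : ℕ) (x : Fin (4*n+7) → ℝ) :
    (adL n x).trace = (2*n+2) * x (a : BasisName n).pos := by
  have h : ∀ i : BasisName n, adL n x i.pos i.pos = brkL n x (stdVec i) i.pos := fun _ => rfl
  simp only [Matrix.trace, Matrix.diag_apply, sum_eq, h]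
  simp [brkL_a, brkL_b, brkL_e₀, brkL_f₀, brkL_e₁, brkL_f₁, brkL_z, brkL_u,
    brkL_v, brkL_e, brkL_f, wedge, stdVec_pos]
  ring

theorem trace_adL_mul_adL (n : ℕ) (x : Fin (4*n+7) → ℝ) :
    (adL n x * adL n x).trace = (2*n+8) * x (a : BasisName n).pos ^ 2 := by
  have h : ∀ i : BasisName n, (adL n x * adL n x) i.pos i.pos =
      brkL n x (brkL n x (stdVec i)) i.pos := fun i => by
    rw [stdVec, ← adL_mulVec, ← adL_mulVec, Matrix.mulVec_mulVec, Matrix.mulVec_single_one]; rfl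
  simp only [Matrix.trace, Matrix.diag_apply, sum_eq, h]
  simp [brkL_a, brkL_b, brkL_e₀, brkL_f₀, brkL_e₁, brkL_f₁, brkL_z, brkL_u,
    brkL_v, brkL_e, brkL_f, wedge, stdVec_pos]
  ring_nf
  simp only [Finset.sum_add_distrib, ← Finset.sum_mul]
  ring
/-- The coordinates of the functional `⟨·, x⟩` in the basis dual to `𝓑`. -/
noncomputable def lower (c ρ : ℝ) {n : ℕ} (x : Fin (4*n+7) → ℝ) : BasisName n → ℝ
  | b => (ρ+c)/ρ * x (b : BasisName n).pos
      - 2*c * ((ρ+c)/(4*ρ^2*(ρ+2*c)) * (x (z : BasisName n).pos - 2*c*x (b : BasisName n).pos))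
  | z => (ρ+c)/(4*ρ^2*(ρ+2*c)) * (x (z : BasisName n).pos - 2*c*x (b : BasisName n).pos)
  | i => gramDiag c ρ i * x i.pos

theorem metric_eq_lower {n : ℕ} {c ρ : ℝ} (hc : 0 ≤ c) (hρ : 0 < ρ) (y x : Fin (4*n+7) → ℝ) :
    metric n c ρ y x =
      y (a : BasisName n).pos * lower c ρ x a + y (b : BasisName n).pos * lower c ρ x b
      + y (e₀ : BasisName n).pos * lower c ρ x e₀ + y (f₀ : BasisName n).pos * lower c ρ x f₀
      + y (e₁ : BasisName n).pos * lower c ρ x e₁ + y (f₁ : BasisName n).pos * lower c ρ x f₁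
      + y (z : BasisName n).pos * lower c ρ x z
      + ∑ t : Fin n, y (u t).pos * lower c ρ x (u t) + ∑ t : Fin n, y (v t).pos * lower c ρ x (v t)
      + ∑ t : Fin n, y (e t).pos * lower c ρ x (e t)
      + ∑ t : Fin n, y (f t).pos * lower c ρ x (f t) := by
  simp only [metric_eq hc hρ, lower, gramDiag, mul_left_comm (y _) ((ρ+c)/(4*ρ)),
    mul_left_comm (y _) (1/(4*ρ)), ← Finset.mul_sum, Finset.sum_add_distrib]
  ring

section frame

variable {n : ℕ} (c ρ : ℝ)

/-- The trace over `𝔩/ℝZ`, for the metric induced by `g_ρ^c`, of a form with diagonal entries `F`. -/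
noncomputable def frameSum (F : BasisName n → ℝ) : ℝ :=
  ρ/(ρ+c) * (F a + F b) + 4*ρ^2/(ρ+2*c) * (F e₀ + F f₀) + 4*ρ * (F e₁ + F f₁)
    + 4*ρ/(ρ+c) * (∑ t, F (u t) + ∑ t, F (v t)) + 4*ρ * (∑ t, F (e t) + ∑ t, F (f t))

variable {c ρ} (hc : 0 ≤ c) (hρ : 0 < ρ) (x y : Fin (4*n+7) → ℝ)

include hc hρ

theorem metric_brkL_a : metric n c ρ (brkL n y (stdVec a)) x =
    -2 * y (b : BasisName n).pos * lower c ρ x b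
    - ∑ t, y (u t).pos * lower c ρ x (u t) - ∑ t, y (v t).pos * lower c ρ x (v t)
    + y (e₁ : BasisName n).pos * lower c ρ x e₀ + y (f₁ : BasisName n).pos * lower c ρ x f₀
    + y (e₀ : BasisName n).pos * lower c ρ x e₁ + y (f₀ : BasisName n).pos * lower c ρ x f₁ := by
  rw [metric_eq_lower hc hρ]
  simp [brkL_a, brkL_b, brkL_e₀, brkL_f₀, brkL_e₁, brkL_f₁, brkL_z, brkL_u,
    brkL_v, brkL_e, brkL_f, wedge, stdVec_pos]
  ring

theorem metric_brkL_b : metric n c ρ (brkL n y (stdVec b)) x =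
    2 * y (a : BasisName n).pos * lower c ρ x b
    + (y (f₀ : BasisName n).pos + y (f₁ : BasisName n).pos) * (lower c ρ x e₁ - lower c ρ x e₀)
    + (y (e₀ : BasisName n).pos + y (e₁ : BasisName n).pos)
      * (lower c ρ x f₀ - lower c ρ x f₁) := by
  rw [metric_eq_lower hc hρ]
  simp [brkL_a, brkL_b, brkL_e₀, brkL_f₀, brkL_e₁, brkL_f₁, brkL_z, brkL_u,
    brkL_v, brkL_e, brkL_f, wedge, stdVec_pos]
  ring

theorem metric_brkL_u (s : Fin n) : metric n c ρ (brkL n y (stdVec (u s))) x =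
    y (a : BasisName n).pos * lower c ρ x (u s) - 1/2 * y (v s).pos * lower c ρ x b
    + 1/2 * y (e s).pos * (lower c ρ x e₀ - lower c ρ x e₁)
    + 1/2 * y (f s).pos * (lower c ρ x f₀ - lower c ρ x f₁)
    + 1/2 * (y (e₀ : BasisName n).pos + y (e₁ : BasisName n).pos) * lower c ρ x (e s)
    + 1/2 * (y (f₀ : BasisName n).pos + y (f₁ : BasisName n).pos) * lower c ρ x (f s) := by
  rw [metric_eq_lower hc hρ]
  simp [brkL_a, brkL_b, brkL_e₀, brkL_f₀, brkL_e₁, brkL_f₁, brkL_z, brkL_u,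
    brkL_v, brkL_e, brkL_f, wedge, stdVec_pos, mul_assoc, mul_add, add_mul,
    Finset.sum_add_distrib]
  ring

theorem metric_brkL_v (s : Fin n) : metric n c ρ (brkL n y (stdVec (v s))) x =
    y (a : BasisName n).pos * lower c ρ x (v s) + 1/2 * y (u s).pos * lower c ρ x b
    - 1/2 * y (f s).pos * (lower c ρ x e₀ - lower c ρ x e₁)
    + 1/2 * y (e s).pos * (lower c ρ x f₀ - lower c ρ x f₁)
    + 1/2 * (y (f₀ : BasisName n).pos + y (f₁ : BasisName n).pos) * lower c ρ x (e s)
    - 1/2 * (y (e₀ : BasisName n).pos + y (e₁ : BasisName n).pos) * lower c ρ x (f s) := by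
  rw [metric_eq_lower hc hρ]
  simp [brkL_a, brkL_b, brkL_e₀, brkL_f₀, brkL_e₁, brkL_f₁, brkL_z, brkL_u,
    brkL_v, brkL_e, brkL_f, wedge, stdVec_pos, mul_assoc, mul_add, add_mul,
    Finset.sum_add_distrib]
  ring

theorem metric_brkL_e₀ : metric n c ρ (brkL n y (stdVec e₀)) x =
    -y (a : BasisName n).pos * lower c ρ x e₁
    + y (b : BasisName n).pos * (lower c ρ x f₁ - lower c ρ x f₀)
    - y (f₀ : BasisName n).pos * lower c ρ x z
    - 1/2 * ∑ t, y (u t).pos * lower c ρ x (e t)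
    + 1/2 * ∑ t, y (v t).pos * lower c ρ x (f t) := by
  rw [metric_eq_lower hc hρ]
  simp [brkL_a, brkL_b, brkL_e₀, brkL_f₀, brkL_e₁, brkL_f₁, brkL_z, brkL_u,
    brkL_v, brkL_e, brkL_f, wedge, stdVec_pos, mul_assoc, ← Finset.mul_sum]
  ring

theorem metric_brkL_f₀ : metric n c ρ (brkL n y (stdVec f₀)) x =
    -y (a : BasisName n).pos * lower c ρ x f₁
    + y (b : BasisName n).pos * (lower c ρ x e₀ - lower c ρ x e₁)
    + y (e₀ : BasisName n).pos * lower c ρ x z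
    - 1/2 * ∑ t, y (u t).pos * lower c ρ x (f t)
    - 1/2 * ∑ t, y (v t).pos * lower c ρ x (e t) := by
  rw [metric_eq_lower hc hρ]
  simp [brkL_a, brkL_b, brkL_e₀, brkL_f₀, brkL_e₁, brkL_f₁, brkL_z, brkL_u,
    brkL_v, brkL_e, brkL_f, wedge, stdVec_pos, mul_assoc, ← Finset.mul_sum]
  ring

theorem metric_brkL_e₁ : metric n c ρ (brkL n y (stdVec e₁)) x =
    -y (a : BasisName n).pos * lower c ρ x e₀
    + y (b : BasisName n).pos * (lower c ρ x f₁ - lower c ρ x f₀)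
    + y (f₁ : BasisName n).pos * lower c ρ x z
    - 1/2 * ∑ t, y (u t).pos * lower c ρ x (e t)
    + 1/2 * ∑ t, y (v t).pos * lower c ρ x (f t) := by
  rw [metric_eq_lower hc hρ]
  simp [brkL_a, brkL_b, brkL_e₀, brkL_f₀, brkL_e₁, brkL_f₁, brkL_z, brkL_u,
    brkL_v, brkL_e, brkL_f, wedge, stdVec_pos, mul_assoc, ← Finset.mul_sum]
  ring

theorem metric_brkL_f₁ : metric n c ρ (brkL n y (stdVec f₁)) x =
    -y (a : BasisName n).pos * lower c ρ x f₀
    + y (b : BasisName n).pos * (lower c ρ x e₀ - lower c ρ x e₁)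
    - y (e₁ : BasisName n).pos * lower c ρ x z
    - 1/2 * ∑ t, y (u t).pos * lower c ρ x (f t)
    - 1/2 * ∑ t, y (v t).pos * lower c ρ x (e t) := by
  rw [metric_eq_lower hc hρ]
  simp [brkL_a, brkL_b, brkL_e₀, brkL_f₀, brkL_e₁, brkL_f₁, brkL_z, brkL_u,
    brkL_v, brkL_e, brkL_f, wedge, stdVec_pos, mul_assoc, ← Finset.mul_sum]
  ring

theorem metric_brkL_e (s : Fin n) : metric n c ρ (brkL n y (stdVec (e s))) x =
    1/2 * y (u s).pos * (lower c ρ x e₁ - lower c ρ x e₀)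
    + 1/2 * y (v s).pos * (lower c ρ x f₁ - lower c ρ x f₀)
    + y (f s).pos * lower c ρ x z := by
  rw [metric_eq_lower hc hρ]
  simp [brkL_a, brkL_b, brkL_e₀, brkL_f₀, brkL_e₁, brkL_f₁, brkL_z, brkL_u,
    brkL_v, brkL_e, brkL_f, wedge, stdVec_pos]
  ring

theorem metric_brkL_f (s : Fin n) : metric n c ρ (brkL n y (stdVec (f s))) x =
    1/2 * y (v s).pos * (lower c ρ x e₀ - lower c ρ x e₁)
    + 1/2 * y (u s).pos * (lower c ρ x f₁ - lower c ρ x f₀)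
    - y (e s).pos * lower c ρ x z := by
  rw [metric_eq_lower hc hρ]
  simp [brkL_a, brkL_b, brkL_e₀, brkL_f₀, brkL_e₁, brkL_f₁, brkL_z, brkL_u,
    brkL_v, brkL_e, brkL_f, wedge, stdVec_pos]
  ring

end frame

section sumOfSquares

variable {n : ℕ} {c ρ : ℝ} (hc : 0 ≤ c) (hρ : 0 < ρ) (x y : Fin (4*n+7) → ℝ)

include hc hρ

theorem metric_brkL_self_a : metric n c ρ (brkL n x (stdVec a)) (brkL n x (stdVec a)) =
    4 * ((ρ+c)/ρ + (ρ+c)/(4*ρ^2*(ρ+2*c)) * (2*c)^2) * x (b : BasisName n).pos ^ 2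
    + (ρ+c)/(4*ρ) * (∑ t, x (u t).pos ^ 2 + ∑ t, x (v t).pos ^ 2)
    + (ρ+2*c)/(4*ρ^2) * (x (e₁ : BasisName n).pos ^ 2 + x (f₁ : BasisName n).pos ^ 2)
    + 1/(4*ρ) * (x (e₀ : BasisName n).pos ^ 2 + x (f₀ : BasisName n).pos ^ 2) := by
  rw [metric_eq hc hρ]
  simp [brkL_a, brkL_b, brkL_e₀, brkL_f₀, brkL_e₁, brkL_f₁,
    brkL_z, brkL_u, brkL_v, brkL_e, brkL_f, wedge, stdVec_pos, Finset.sum_add_distrib, ← pow_two]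
  ring

theorem metric_brkL_self_b : metric n c ρ (brkL n x (stdVec b)) (brkL n x (stdVec b)) =
    4 * ((ρ+c)/ρ + (ρ+c)/(4*ρ^2*(ρ+2*c)) * (2*c)^2) * x (a : BasisName n).pos ^ 2
    + ((ρ+2*c)/(4*ρ^2) + 1/(4*ρ)) * ((x (e₀ : BasisName n).pos + x (e₁ : BasisName n).pos) ^ 2
      + (x (f₀ : BasisName n).pos + x (f₁ : BasisName n).pos) ^ 2) := by
  rw [metric_eq hc hρ]
  simp [brkL_a, brkL_b, brkL_e₀, brkL_f₀, brkL_e₁, brkL_f₁,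
    brkL_z, brkL_u, brkL_v, brkL_e, brkL_f, wedge, stdVec_pos]
  ring

theorem metric_brkL_self_u (s : Fin n) :
    metric n c ρ (brkL n x (stdVec (u s))) (brkL n x (stdVec (u s))) =
    ((ρ+c)/ρ + (ρ+c)/(4*ρ^2*(ρ+2*c)) * (2*c)^2) * (x (v s).pos ^ 2 / 4)
    + (ρ+c)/(4*ρ) * x (a : BasisName n).pos ^ 2
    + ((ρ+2*c)/(4*ρ^2) + 1/(4*ρ)) * ((x (e s).pos ^ 2 + x (f s).pos ^ 2) / 4)
    + 1/(16*ρ) * ((x (e₀ : BasisName n).pos + x (e₁ : BasisName n).pos) ^ 2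
      + (x (f₀ : BasisName n).pos + x (f₁ : BasisName n).pos) ^ 2) := by
  rw [metric_eq hc hρ]
  simp [brkL_a, brkL_b, brkL_e₀, brkL_f₀, brkL_e₁, brkL_f₁,
    brkL_z, brkL_u, brkL_v, brkL_e, brkL_f, wedge, stdVec_pos, Finset.sum_add_distrib]
  ring_nf
  simp [Finset.sum_add_distrib]
  ring

theorem metric_brkL_self_v (s : Fin n) :
    metric n c ρ (brkL n x (stdVec (v s))) (brkL n x (stdVec (v s))) =
    ((ρ+c)/ρ + (ρ+c)/(4*ρ^2*(ρ+2*c)) * (2*c)^2) * (x (u s).pos ^ 2 / 4)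
    + (ρ+c)/(4*ρ) * x (a : BasisName n).pos ^ 2
    + ((ρ+2*c)/(4*ρ^2) + 1/(4*ρ)) * ((x (e s).pos ^ 2 + x (f s).pos ^ 2) / 4)
    + 1/(16*ρ) * ((x (e₀ : BasisName n).pos + x (e₁ : BasisName n).pos) ^ 2
      + (x (f₀ : BasisName n).pos + x (f₁ : BasisName n).pos) ^ 2) := by
  rw [metric_eq hc hρ]
  simp [brkL_a, brkL_b, brkL_e₀, brkL_f₀, brkL_e₁, brkL_f₁,
    brkL_z, brkL_u, brkL_v, brkL_e, brkL_f, wedge, stdVec_pos, Finset.sum_add_distrib]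
  ring_nf
  simp [Finset.sum_add_distrib]
  ring

theorem metric_brkL_self_e₀ : metric n c ρ (brkL n x (stdVec e₀)) (brkL n x (stdVec e₀)) =
    1/(4*ρ) * x (a : BasisName n).pos ^ 2
    + ((ρ+2*c)/(4*ρ^2) + 1/(4*ρ)) * x (b : BasisName n).pos ^ 2
    + 1/(16*ρ) * (∑ t, x (u t).pos ^ 2 + ∑ t, x (v t).pos ^ 2)
    + (ρ+c)/(4*ρ^2*(ρ+2*c)) * x (f₀ : BasisName n).pos ^ 2 := by
  rw [metric_eq hc hρ]
  simp [brkL_a, brkL_b, brkL_e₀, brkL_f₀, brkL_e₁, brkL_f₁,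
    brkL_z, brkL_u, brkL_v, brkL_e, brkL_f, wedge, stdVec_pos]
  ring_nf
  simp only [Finset.sum_add_distrib, ← Finset.sum_mul]
  ring

theorem metric_brkL_self_f₀ : metric n c ρ (brkL n x (stdVec f₀)) (brkL n x (stdVec f₀)) =
    1/(4*ρ) * x (a : BasisName n).pos ^ 2
    + ((ρ+2*c)/(4*ρ^2) + 1/(4*ρ)) * x (b : BasisName n).pos ^ 2
    + 1/(16*ρ) * (∑ t, x (u t).pos ^ 2 + ∑ t, x (v t).pos ^ 2)
    + (ρ+c)/(4*ρ^2*(ρ+2*c)) * x (e₀ : BasisName n).pos ^ 2 := by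
  rw [metric_eq hc hρ]
  simp [brkL_a, brkL_b, brkL_e₀, brkL_f₀, brkL_e₁, brkL_f₁,
    brkL_z, brkL_u, brkL_v, brkL_e, brkL_f, wedge, stdVec_pos]
  ring_nf
  simp only [Finset.sum_add_distrib, ← Finset.sum_mul]
  ring

theorem metric_brkL_self_e₁ : metric n c ρ (brkL n x (stdVec e₁)) (brkL n x (stdVec e₁)) =
    (ρ+2*c)/(4*ρ^2) * x (a : BasisName n).pos ^ 2
    + ((ρ+2*c)/(4*ρ^2) + 1/(4*ρ)) * x (b : BasisName n).pos ^ 2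
    + 1/(16*ρ) * (∑ t, x (u t).pos ^ 2 + ∑ t, x (v t).pos ^ 2)
    + (ρ+c)/(4*ρ^2*(ρ+2*c)) * x (f₁ : BasisName n).pos ^ 2 := by
  rw [metric_eq hc hρ]
  simp [brkL_a, brkL_b, brkL_e₀, brkL_f₀, brkL_e₁, brkL_f₁,
    brkL_z, brkL_u, brkL_v, brkL_e, brkL_f, wedge, stdVec_pos]
  ring_nf
  simp only [Finset.sum_add_distrib, ← Finset.sum_mul]
  ring

theorem metric_brkL_self_f₁ : metric n c ρ (brkL n x (stdVec f₁)) (brkL n x (stdVec f₁)) =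
    (ρ+2*c)/(4*ρ^2) * x (a : BasisName n).pos ^ 2
    + ((ρ+2*c)/(4*ρ^2) + 1/(4*ρ)) * x (b : BasisName n).pos ^ 2
    + 1/(16*ρ) * (∑ t, x (u t).pos ^ 2 + ∑ t, x (v t).pos ^ 2)
    + (ρ+c)/(4*ρ^2*(ρ+2*c)) * x (e₁ : BasisName n).pos ^ 2 := by
  rw [metric_eq hc hρ]
  simp [brkL_a, brkL_b, brkL_e₀, brkL_f₀, brkL_e₁, brkL_f₁,
    brkL_z, brkL_u, brkL_v, brkL_e, brkL_f, wedge, stdVec_pos]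
  ring_nf
  simp only [Finset.sum_add_distrib, ← Finset.sum_mul]
  ring

theorem metric_brkL_self_e (s : Fin n) :
    metric n c ρ (brkL n x (stdVec (e s))) (brkL n x (stdVec (e s))) =
    ((ρ+2*c)/(4*ρ^2) + 1/(4*ρ)) * ((x (u s).pos ^ 2 + x (v s).pos ^ 2) / 4)
    + (ρ+c)/(4*ρ^2*(ρ+2*c)) * x (f s).pos ^ 2 := by
  rw [metric_eq hc hρ]
  simp [brkL_a, brkL_b, brkL_e₀, brkL_f₀, brkL_e₁, brkL_f₁,
    brkL_z, brkL_u, brkL_v, brkL_e, brkL_f, wedge, stdVec_pos]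
  ring

theorem metric_brkL_self_f (s : Fin n) :
    metric n c ρ (brkL n x (stdVec (f s))) (brkL n x (stdVec (f s))) =
    ((ρ+2*c)/(4*ρ^2) + 1/(4*ρ)) * ((x (u s).pos ^ 2 + x (v s).pos ^ 2) / 4)
    + (ρ+c)/(4*ρ^2*(ρ+2*c)) * x (e s).pos ^ 2 := by
  rw [metric_eq hc hρ]
  simp [brkL_a, brkL_b, brkL_e₀, brkL_f₀, brkL_e₁, brkL_f₁,
    brkL_z, brkL_u, brkL_v, brkL_e, brkL_f, wedge, stdVec_pos]
  ring

end sumOfSquares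

section sumOfSquares

variable {n : ℕ} {c ρ : ℝ} (hc : 0 ≤ c) (hρ : 0 < ρ) (x : Fin (4*n+7) → ℝ)

include hc hρ

theorem frameSum_metric_brkL_sq_a :
    frameSum c ρ (fun i => metric n c ρ (brkL n (stdVec i) (stdVec a)) x ^ 2) =
    4 * (ρ/(ρ+c)) * lower c ρ x b ^ 2 + 4*ρ/(ρ+c) * (∑ t, lower c ρ x (u t) ^ 2 + ∑ t, lower c ρ x (v t) ^ 2)
    + 4*ρ * (lower c ρ x e₀ ^ 2 + lower c ρ x f₀ ^ 2) + 4*ρ^2/(ρ+2*c) * (lower c ρ x e₁ ^ 2 + lower c ρ x f₁ ^ 2) := by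
  simp [frameSum, metric_brkL_a hc hρ, stdVec_pos]
  ring

theorem frameSum_metric_brkL_sq_b :
    frameSum c ρ (fun i => metric n c ρ (brkL n (stdVec i) (stdVec b)) x ^ 2) =
    4 * (ρ/(ρ+c)) * lower c ρ x b ^ 2
    + (4*ρ^2/(ρ+2*c) + 4*ρ) * ((lower c ρ x e₁ - lower c ρ x e₀) ^ 2 + (lower c ρ x f₁ - lower c ρ x f₀) ^ 2) := by
  simp [frameSum, metric_brkL_b hc hρ, stdVec_pos]
  ring

theorem frameSum_metric_brkL_sq_u (s : Fin n) :
    frameSum c ρ (fun i => metric n c ρ (brkL n (stdVec i) (stdVec (u s))) x ^ 2) =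
    ρ/(ρ+c) * lower c ρ x b ^ 2 + ρ/(ρ+c) * lower c ρ x (u s) ^ 2 + ρ * ((lower c ρ x e₁ - lower c ρ x e₀) ^ 2 + (lower c ρ x f₁ - lower c ρ x f₀) ^ 2)
    + (ρ^2/(ρ+2*c) + ρ) * (lower c ρ x (e s) ^ 2 + lower c ρ x (f s) ^ 2) := by
  simp [frameSum, metric_brkL_u hc hρ, stdVec_pos]
  ring

theorem frameSum_metric_brkL_sq_v (s : Fin n) :
    frameSum c ρ (fun i => metric n c ρ (brkL n (stdVec i) (stdVec (v s))) x ^ 2) =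
    ρ/(ρ+c) * lower c ρ x b ^ 2 + ρ/(ρ+c) * lower c ρ x (v s) ^ 2 + ρ * ((lower c ρ x e₁ - lower c ρ x e₀) ^ 2 + (lower c ρ x f₁ - lower c ρ x f₀) ^ 2)
    + (ρ^2/(ρ+2*c) + ρ) * (lower c ρ x (e s) ^ 2 + lower c ρ x (f s) ^ 2) := by
  simp [frameSum, metric_brkL_v hc hρ, stdVec_pos]
  ring

theorem frameSum_metric_brkL_sq_e₀ :
    frameSum c ρ (fun i => metric n c ρ (brkL n (stdVec i) (stdVec e₀)) x ^ 2) =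
    ρ/(ρ+c) * (lower c ρ x e₁ ^ 2 + (lower c ρ x f₁ - lower c ρ x f₀) ^ 2)
    + ρ/(ρ+c) * (∑ t, lower c ρ x (e t) ^ 2 + ∑ t, lower c ρ x (f t) ^ 2) + 4*ρ^2/(ρ+2*c) * lower c ρ x z ^ 2 := by
  simp [frameSum, metric_brkL_e₀ hc hρ, stdVec_pos]
  ring_nf
  simp only [← Finset.sum_mul]
  ring

theorem frameSum_metric_brkL_sq_f₀ :
    frameSum c ρ (fun i => metric n c ρ (brkL n (stdVec i) (stdVec f₀)) x ^ 2) =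
    ρ/(ρ+c) * (lower c ρ x f₁ ^ 2 + (lower c ρ x e₁ - lower c ρ x e₀) ^ 2)
    + ρ/(ρ+c) * (∑ t, lower c ρ x (e t) ^ 2 + ∑ t, lower c ρ x (f t) ^ 2) + 4*ρ^2/(ρ+2*c) * lower c ρ x z ^ 2 := by
  simp [frameSum, metric_brkL_f₀ hc hρ, stdVec_pos]
  ring_nf
  simp only [← Finset.sum_mul]
  ring

theorem frameSum_metric_brkL_sq_e₁ :
    frameSum c ρ (fun i => metric n c ρ (brkL n (stdVec i) (stdVec e₁)) x ^ 2) =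
    ρ/(ρ+c) * (lower c ρ x e₀ ^ 2 + (lower c ρ x f₁ - lower c ρ x f₀) ^ 2)
    + ρ/(ρ+c) * (∑ t, lower c ρ x (e t) ^ 2 + ∑ t, lower c ρ x (f t) ^ 2) + 4*ρ * lower c ρ x z ^ 2 := by
  simp [frameSum, metric_brkL_e₁ hc hρ, stdVec_pos]
  ring_nf
  simp only [← Finset.sum_mul]
  ring

theorem frameSum_metric_brkL_sq_f₁ :
    frameSum c ρ (fun i => metric n c ρ (brkL n (stdVec i) (stdVec f₁)) x ^ 2) =
    ρ/(ρ+c) * (lower c ρ x f₀ ^ 2 + (lower c ρ x e₁ - lower c ρ x e₀) ^ 2)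
    + ρ/(ρ+c) * (∑ t, lower c ρ x (e t) ^ 2 + ∑ t, lower c ρ x (f t) ^ 2) + 4*ρ * lower c ρ x z ^ 2 := by
  simp [frameSum, metric_brkL_f₁ hc hρ, stdVec_pos]
  ring_nf
  simp only [← Finset.sum_mul]
  ring

theorem frameSum_metric_brkL_sq_e (s : Fin n) :
    frameSum c ρ (fun i => metric n c ρ (brkL n (stdVec i) (stdVec (e s))) x ^ 2) =
    ρ/(ρ+c) * ((lower c ρ x e₁ - lower c ρ x e₀) ^ 2 + (lower c ρ x f₁ - lower c ρ x f₀) ^ 2) + 4*ρ * lower c ρ x z ^ 2 := by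
  simp [frameSum, metric_brkL_e hc hρ, stdVec_pos]
  ring

theorem frameSum_metric_brkL_sq_f (s : Fin n) :
    frameSum c ρ (fun i => metric n c ρ (brkL n (stdVec i) (stdVec (f s))) x ^ 2) =
    ρ/(ρ+c) * ((lower c ρ x e₁ - lower c ρ x e₀) ^ 2 + (lower c ρ x f₁ - lower c ρ x f₀) ^ 2) + 4*ρ * lower c ρ x z ^ 2 := by
  simp [frameSum, metric_brkL_f hc hρ, stdVec_pos]
  ring

end sumOfSquares

/-- The Ricci endomorphism of `(𝔩, g_ρ^c)` in the ordered basis `𝓑`. -/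
noncomputable def ricci (n : ℕ) (c ρ : ℝ) : Matrix (Fin (4*n+7)) (Fin (4*n+7)) ℝ :=
  Matrix.of (fun i j : Fin (4*n+7) =>
    let N : ℝ := (n : ℝ) + 2
    let r₁ : ℝ := (-2*(N+2)*ρ^2 - 4*(N+2)*c*ρ - 6*c^2)/((ρ+c)*(ρ+2*c))
    let r₂ : ℝ := (2*N*ρ^4 + (12*N-8)*c*ρ^3 + (28*N-26)*c^2*ρ^2
        + 32*(N-1)*c^3*ρ + 16*(N-1)*c^4)/((ρ+c)*(ρ+2*c)^3)
    let r₃ : ℝ := 2*(-ρ^3 + (2*N-3)*c*ρ^2 + 8*(N-1)*c^2*ρ + 8*(N-1)*c^3)/(ρ+2*c)^3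
    let r₄ : ℝ := -2*(ρ+3*c)/(ρ+2*c)
    if i = j then
      (if (i:ℕ) < 2*n+2 then r₁
       else if (i:ℕ) < 2*n+4 then r₃
       else if (i:ℕ) < 4*n+6 then r₄
       else r₂)
    else if (i:ℕ) = 4*n+6 ∧ (j:ℕ) = 1 then 2*c*(r₁-r₂)
    else 0)

/-- The diagonal of `ricci`. -/
noncomputable def ricDiag (c ρ : ℝ) {n : ℕ} : BasisName n → ℝ
  | a | b | u _ | v _ =>
    (-2*((n:ℝ)+2+2)*ρ^2 - 4*((n:ℝ)+2+2)*c*ρ - 6*c^2)/((ρ+c)*(ρ+2*c))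
  | e₀ | f₀ =>
    2*(-ρ^3 + (2*((n:ℝ)+2)-3)*c*ρ^2 + 8*((n:ℝ)+2-1)*c^2*ρ + 8*((n:ℝ)+2-1)*c^3)/(ρ+2*c)^3
  | e₁ | f₁ | e _ | f _ => -2*(ρ+3*c)/(ρ+2*c)
  | z => (2*((n:ℝ)+2)*ρ^4 + (12*((n:ℝ)+2)-8)*c*ρ^3 + (28*((n:ℝ)+2)-26)*c^2*ρ^2
      + 32*((n:ℝ)+2-1)*c^3*ρ + 16*((n:ℝ)+2-1)*c^4)/((ρ+c)*(ρ+2*c)^3)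

theorem ricci_pos (n : ℕ) (c ρ : ℝ) (i j : BasisName n) :
    ricci n c ρ i.pos j.pos = if i = j then ricDiag c ρ i
      else if i = z ∧ j = b then 2*c*(ricDiag c ρ (b : BasisName n) - ricDiag c ρ (z : BasisName n))
      else 0 := by
  have hb : ∀ k : BasisName n, (k.pos : ℕ) = 1 ↔ k = b := fun k => by
    rw [← pos_inj, Fin.ext_iff]; rfl
  have hz : ∀ k : BasisName n, (k.pos : ℕ) = 4*n+6 ↔ k = z := fun k => by
    rw [← pos_inj, Fin.ext_iff]; rfl
  simp only [ricci, Matrix.of_apply, pos_inj, hz, hb]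
  refine if_congr Iff.rfl ?_ rfl
  cases i <;> simp only [ricDiag] <;> split_ifs <;> first
    | rfl
    | exfalso; simp only [pos] at *; omega

theorem ricci_mulVec_pos (n : ℕ) (c ρ : ℝ) (x : Fin (4*n+7) → ℝ) (i : BasisName n) :
    (ricci n c ρ).mulVec x i.pos = ricDiag c ρ i * x i.pos
      + if i = z then 2*c*(ricDiag c ρ (b : BasisName n) - ricDiag c ρ (z : BasisName n))
        * x (b : BasisName n).pos else 0 := by
  rw [Matrix.mulVec, dotProduct, sum_eq]
  simp only [ricci_pos]
  cases i <;> simp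
  ring

theorem metric_ricci {n : ℕ} {c ρ : ℝ} (hc : 0 ≤ c) (hρ : 0 < ρ) (x y : Fin (4*n+7) → ℝ) :
    metric n c ρ ((ricci n c ρ).mulVec x) y =
      ricDiag c ρ (a : BasisName n) * ((ρ+c)/ρ * (x (a : BasisName n).pos * y (a : BasisName n).pos
        + x (b : BasisName n).pos * y (b : BasisName n).pos)
      + (ρ+c)/(4*ρ) * ∑ t : Fin n, (x (u t).pos * y (u t).pos + x (v t).pos * y (v t).pos))
      + ricDiag c ρ (e₀ : BasisName n) * ((ρ+2*c)/(4*ρ^2)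
        * (x (e₀ : BasisName n).pos * y (e₀ : BasisName n).pos
        + x (f₀ : BasisName n).pos * y (f₀ : BasisName n).pos))
      + ricDiag c ρ (e₁ : BasisName n) * (1/(4*ρ)
        * (x (e₁ : BasisName n).pos * y (e₁ : BasisName n).pos
        + x (f₁ : BasisName n).pos * y (f₁ : BasisName n).pos
        + ∑ t : Fin n, (x (e t).pos * y (e t).pos + x (f t).pos * y (f t).pos)))
      + ricDiag c ρ (z : BasisName n) * ((ρ+c)/(4*ρ^2*(ρ+2*c))
        * ((x (z : BasisName n).pos - 2*c*x (b : BasisName n).pos)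
        * (y (z : BasisName n).pos - 2*c*y (b : BasisName n).pos))) := by
  rw [metric_eq hc hρ]
  simp only [ricci_mulVec_pos, reduceCtorEq, if_false, if_true, add_zero]
  simp only [ricDiag, mul_assoc, ← Finset.mul_sum, ← mul_add]
  ring

theorem ricci_quadratic {n : ℕ} {c ρ : ℝ} (hc : 0 ≤ c) (hρ : 0 < ρ) (x : Fin (4*n+7) → ℝ) :
    -(1/2) * frameSum c ρ (fun i => metric n c ρ (brkL n x (stdVec i)) (brkL n x (stdVec i)))
      + 1/4 * frameSum c ρ (fun j => frameSum c ρ (fun i =>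
        metric n c ρ (brkL n (stdVec i) (stdVec j)) x ^ 2))
      - 1/2 * ((2*n+8) * x (a : BasisName n).pos ^ 2)
      + (2*n+2) * (ρ/(ρ+c)) * metric n c ρ (brkL n x (stdVec a)) x
      = metric n c ρ ((ricci n c ρ).mulVec x) x := by
  have hs : ρ + c ≠ 0 := by positivity
  have hs2 : ρ + 2*c ≠ 0 := by positivity
  rw [metric_ricci hc hρ, metric_brkL_a hc hρ, frameSum, frameSum]
  simp only [frameSum_metric_brkL_sq_a hc hρ, frameSum_metric_brkL_sq_b hc hρ,
    frameSum_metric_brkL_sq_u hc hρ, frameSum_metric_brkL_sq_v hc hρ,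
    frameSum_metric_brkL_sq_e₀ hc hρ, frameSum_metric_brkL_sq_f₀ hc hρ,
    frameSum_metric_brkL_sq_e₁ hc hρ, frameSum_metric_brkL_sq_f₁ hc hρ,
    frameSum_metric_brkL_sq_e hc hρ, frameSum_metric_brkL_sq_f hc hρ,
    metric_brkL_self_a hc hρ, metric_brkL_self_b hc hρ, metric_brkL_self_u hc hρ,
    metric_brkL_self_v hc hρ, metric_brkL_self_e₀ hc hρ, metric_brkL_self_f₀ hc hρ,
    metric_brkL_self_e₁ hc hρ, metric_brkL_self_f₁ hc hρ, metric_brkL_self_e hc hρ,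
    metric_brkL_self_f hc hρ, ← pow_two, mul_left_comm (x _) ((ρ+c)/(4*ρ)), mul_pow, lower, ricDiag, gramDiag, Finset.sum_add_distrib,
    ← Finset.mul_sum, ← Finset.sum_div, Finset.sum_const, Finset.card_univ, Fintype.card_fin,
    nsmul_eq_mul]
  generalize ∑ t, x (u t).pos ^ 2 = SU
  generalize ∑ t, x (v t).pos ^ 2 = SV
  generalize ∑ t, x (e t).pos ^ 2 = SE
  generalize ∑ t, x (f t).pos ^ 2 = SF
  field_simp
  ring

section orthonormal

variable {n : ℕ} {c ρ : ℝ} {L : Fin (4*n+7) → (Fin (4*n+7) → ℝ)}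
  (hL : ∀ i j, metric n c ρ (L i) (L j) = if i = j then (1:ℝ) else 0)

include hL

/-- Expansion of a vector in an orthonormal basis. -/
theorem sum_metric_smul (w : Fin (4*n+7) → ℝ) : ∑ i, metric n c ρ (L i) w • L i = w := by
  have h : (Matrix.of L * GramL n c ρ) * (Matrix.of L)ᵀ = 1 := by
    ext i j
    rw [Matrix.mul_assoc, Matrix.one_apply, ← hL i j]
    rfl
  rw [mul_eq_one_comm] at h
  have h2 := congrArg (fun M => M.mulVec w) h
  simp only [one_mulVec, ← Matrix.mulVec_mulVec] at h2
  refine Eq.trans ?_ h2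
  rw [Matrix.mulVec_transpose]
  funext k
  simp only [Finset.sum_apply, Pi.smul_apply, smul_eq_mul]
  rfl

theorem eq_of_forall_metric_eq {v w : Fin (4*n+7) → ℝ}
    (h : ∀ y, metric n c ρ v y = metric n c ρ w y) : v = w := by
  rw [← sum_metric_smul hL v, ← sum_metric_smul hL w]
  exact Finset.sum_congr rfl fun i _ => by rw [metric_comm, h, metric_comm]

/-- The trace of a bilinear form that descends to `𝔩/ℝZ`. -/
theorem sum_frame (hc : 0 ≤ c) (hρ : 0 < ρ)
    (B : (Fin (4*n+7) → ℝ) →ₗ[ℝ] (Fin (4*n+7) → ℝ) →ₗ[ℝ] ℝ)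
    (hl : ∀ y, B (stdVec z) y = 0) (hr : ∀ x, B x (stdVec z) = 0) :
    ∑ i, B (L i) (L i) = frameSum c ρ (fun k => B (stdVec k) (stdVec k)) := by
  have hs : ρ + c ≠ 0 := by positivity
  have hs2 : ρ + 2*c ≠ 0 := by positivity
  have coord : ∀ (k : BasisName n) (w : Fin (4*n+7) → ℝ),
      (∀ x, x k.pos = metric n c ρ x w) →
      ∑ i, L i k.pos * B (L i) (stdVec k) = B w (stdVec k) := by
    intro k w hw
    conv_rhs => rw [← sum_metric_smul hL w]
    simp [hw]
  have expand : ∀ i, B (L i) (L i) = ∑ k, L i k * B (L i) (Pi.single k 1) := by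
    intro i
    refine (congrArg (B (L i)) (pi_eq_sum_univ' (L i))).trans ?_
    simp only [map_sum, map_smul, smul_eq_mul]
  simp only [expand]
  rw [Finset.sum_comm, sum_eq]
  simp only [← stdVec.eq_1, hr, mul_zero, Finset.sum_const_zero, add_zero]
  have diag : ∀ k : BasisName n, k ≠ b → k ≠ z →
      ∑ i, L i k.pos * B (L i) (stdVec k) = (gramDiag c ρ k)⁻¹ * B (stdVec k) (stdVec k) := by
    intro k hb hz
    rw [coord k ((gramDiag c ρ k)⁻¹ • stdVec k), map_smul, LinearMap.smul_apply, smul_eq_mul]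
    intro x
    rw [metric_eq hc hρ]
    cases k <;> simp [stdVec_pos, gramDiag] at hb hz ⊢ <;> field_simp
  have hbb : ∑ i, L i (b : BasisName n).pos * B (L i) (stdVec b) =
      ρ/(ρ+c) * B (stdVec b) (stdVec b) := by
    rw [coord b ((ρ/(ρ+c)) • (stdVec b + (2*c) • stdVec z))]
    · simp [hl]
    intro x
    rw [metric_eq hc hρ]
    simp [stdVec_pos]
    field_simp
    ring
  rw [hbb, diag a, diag e₀, diag f₀, diag e₁, diag f₁]
  · simp [diag, Finset.sum_add_distrib, gramDiag, ← Finset.mul_sum, frameSum]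
    ring
  all_goals simp

end orthonormal

/-- Two symmetric bilinear forms with the same quadratic form agree. -/
theorem eq_of_quadratic_eq {V : Type*} [AddCommGroup V] [Module ℝ V] {B C : V →ₗ[ℝ] V →ₗ[ℝ] ℝ}
    (hB : ∀ x y, B x y = B y x) (hC : ∀ x y, C x y = C y x) (h : ∀ x, B x x = C x x) (x y : V) :
    B x y = C x y := by
  have h1 := h (x + y)
  simp only [map_add, LinearMap.add_apply] at h1
  linarith [h x, h y, hB x y, hC x y]

theorem brkL_stdVec_z (n : ℕ) (x : Fin (4*n+7) → ℝ) : brkL n x (stdVec z) = 0 := by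
  funext k
  obtain ⟨i, rfl⟩ := exists_pos_eq k
  cases i <;> simp [brkL_a, brkL_b, brkL_e₀, brkL_f₀, brkL_e₁, brkL_f₁, brkL_z, brkL_u,
    brkL_v, brkL_e, brkL_f, wedge, stdVec_pos]

section orthonormal

variable {n : ℕ} {c ρ : ℝ} (hc : 0 ≤ c) (hρ : 0 < ρ) {L : Fin (4*n+7) → (Fin (4*n+7) → ℝ)}
  (hL : ∀ i j, metric n c ρ (L i) (L j) = if i = j then (1:ℝ) else 0) (x : Fin (4*n+7) → ℝ)

include hc hρ hL

theorem sum_metric_brkL_self :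
    ∑ i, metric n c ρ (brkL n x (L i)) (brkL n x (L i)) =
      frameSum c ρ (fun i => metric n c ρ (brkL n x (stdVec i)) (brkL n x (stdVec i))) :=
  sum_frame hL hc hρ ((metricForm n c ρ).compl₁₂ (bracket n x) (bracket n x))
    (fun y => by simp [brkL_stdVec_z]) (fun y => by simp [brkL_stdVec_z, metric])

theorem sum_metric_brkL_sq_right (y : Fin (4*n+7) → ℝ) :
    ∑ i, metric n c ρ (brkL n (L i) y) x ^ 2 =
      frameSum c ρ (fun i => metric n c ρ (brkL n (stdVec i) y) x ^ 2) := by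
  let φ : (Fin (4*n+7) → ℝ) →ₗ[ℝ] ℝ := (metricForm n c ρ).flip x ∘ₗ (bracket n).flip y
  have h : brkL n (stdVec z) y = 0 := by rw [brkL_swap, brkL_stdVec_z, neg_zero]
  simpa [φ, pow_two] using sum_frame hL hc hρ ((LinearMap.mul ℝ ℝ).compl₁₂ φ φ)
    (fun y => by simp [φ, h, metric]) (fun y => by simp [φ, h, metric])

theorem sum_metric_brkL_sq_left (y : Fin (4*n+7) → ℝ) :
    ∑ i, metric n c ρ (brkL n y (L i)) x ^ 2 =
      frameSum c ρ (fun i => metric n c ρ (brkL n y (stdVec i)) x ^ 2) := by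
  let φ : (Fin (4*n+7) → ℝ) →ₗ[ℝ] ℝ := (metricForm n c ρ).flip x ∘ₗ bracket n y
  simpa [φ, pow_two] using sum_frame hL hc hρ ((LinearMap.mul ℝ ℝ).compl₁₂ φ φ)
    (fun y => by simp [φ, brkL_stdVec_z, metric]) (fun y => by simp [φ, brkL_stdVec_z, metric])

theorem sum_sum_metric_brkL_sq :
    ∑ i, ∑ j, metric n c ρ (brkL n (L i) (L j)) x ^ 2 =
      frameSum c ρ (fun j => frameSum c ρ (fun i =>
        metric n c ρ (brkL n (stdVec i) (stdVec j)) x ^ 2)) := by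
  have h : ∀ (F : Fin (4*n+7) → BasisName n → ℝ),
      ∑ i, frameSum c ρ (F i) = frameSum c ρ (fun j => ∑ i, F i j) := by
    intro F
    simp only [frameSum, Finset.sum_add_distrib, ← Finset.mul_sum]
    simp only [Finset.sum_comm (γ := Fin (4*n+7))]
  simp only [sum_metric_brkL_sq_left hc hρ hL, h, sum_metric_brkL_sq_right hc hρ hL]

/-- The mean curvature vector. -/
theorem eq_smul_stdVec {H : Fin (4*n+7) → ℝ}
    (hH : ∀ x, metric n c ρ H x = (adL n x).trace) :
    H = ((2*n+2) * (ρ/(ρ+c))) • stdVec a := by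
  have hs : ρ + c ≠ 0 := by positivity
  refine eq_of_forall_metric_eq hL fun y => ?_
  rw [hH, trace_adL, metric_eq hc hρ]
  simp [stdVec_pos]
  field_simp

end orthonormal

/-- for paper `n ≥ 2` (our `n+2`), `c ≥ 0`, `ρ > 0`, the Ricci
endomorphism of `(𝔩, g_ρ^c)` is, in the ordered basis `𝓑`, the matrix
`diag(r₁·1_{2n+2}, r₃·1₂, r₄·1_{2n+2}, r₂) + 2c(r₁-r₂)·E_{4n+6,1}` (0-indexed; this is
the paper's `E_{4n-1,2}`), where `r₁,…,r₄` are the stated rational functions of `ρ,c`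
and the paper's `n` (our `N = n+2`).  The Ricci endomorphism
`ric = R - (1/2)B - (1/2)(ad H + (ad H)*)` is transcribed through matrices in the basis
`𝓑` via its defining data: an orthonormal basis `L` of `g_ρ^c`, the mean curvature
vector `H`, the Killing operator `B`, the curvature operator `R`, and the metric adjoint
`adHs` of `ad H`. -/
theorem statement13 (n : ℕ) (c ρ : ℝ) (hc : 0 ≤ c) (hρ : 0 < ρ)
    (L : Fin (4*n+7) → (Fin (4*n+7) → ℝ))
    (hL : ∀ i j, L i ⬝ᵥ (GramL n c ρ).mulVec (L j) = if i = j then (1:ℝ) else 0)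
    (H : Fin (4*n+7) → ℝ)
    (hH : ∀ x, H ⬝ᵥ (GramL n c ρ).mulVec x = (adL n x).trace)
    (Bm : Matrix (Fin (4*n+7)) (Fin (4*n+7)) ℝ)
    (hB : ∀ x y, (Bm.mulVec x) ⬝ᵥ (GramL n c ρ).mulVec y = (adL n x * adL n y).trace)
    (Rm : Matrix (Fin (4*n+7)) (Fin (4*n+7)) ℝ)
    (hR : ∀ x y, (Rm.mulVec x) ⬝ᵥ (GramL n c ρ).mulVec y =
      -(1/2) * (∑ i, (brkL n x (L i)) ⬝ᵥ (GramL n c ρ).mulVec (brkL n y (L i)))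
      + (1/4) * (∑ i, ∑ j,
          ((brkL n (L i) (L j)) ⬝ᵥ (GramL n c ρ).mulVec x)
            * ((brkL n (L i) (L j)) ⬝ᵥ (GramL n c ρ).mulVec y)))
    (adHs : Matrix (Fin (4*n+7)) (Fin (4*n+7)) ℝ)
    (hadHs : ∀ x y, ((adL n H).mulVec x) ⬝ᵥ (GramL n c ρ).mulVec y
      = x ⬝ᵥ (GramL n c ρ).mulVec (adHs.mulVec y)) :
    Rm - (1/2 : ℝ) • Bm - (1/2 : ℝ) • (adL n H + adHs) =
      Matrix.of (fun i j : Fin (4*n+7) =>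
        let N : ℝ := (n : ℝ) + 2
        let r₁ : ℝ := (-2*(N+2)*ρ^2 - 4*(N+2)*c*ρ - 6*c^2)/((ρ+c)*(ρ+2*c))
        let r₂ : ℝ := (2*N*ρ^4 + (12*N-8)*c*ρ^3 + (28*N-26)*c^2*ρ^2
            + 32*(N-1)*c^3*ρ + 16*(N-1)*c^4)/((ρ+c)*(ρ+2*c)^3)
        let r₃ : ℝ := 2*(-ρ^3 + (2*N-3)*c*ρ^2 + 8*(N-1)*c^2*ρ + 8*(N-1)*c^3)/(ρ+2*c)^3
        let r₄ : ℝ := -2*(ρ+3*c)/(ρ+2*c)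
        if i = j then
          (if (i:ℕ) < 2*n+2 then r₁
           else if (i:ℕ) < 2*n+4 then r₃
           else if (i:ℕ) < 4*n+6 then r₄
           else r₂)
        else if (i:ℕ) = 4*n+6 ∧ (j:ℕ) = 1 then 2*c*(r₁-r₂)
        else 0) := by
  have hH' := eq_smul_stdVec hc hρ hL hH
  have hB' : ∀ x y, metric n c ρ (Bm.mulVec x) y = (adL n x * adL n y).trace := hB
  have hR' : ∀ x y, metric n c ρ (Rm.mulVec x) y =
      -(1/2) * (∑ i, metric n c ρ (brkL n x (L i)) (brkL n y (L i)))
      + (1/4) * (∑ i, ∑ j, metric n c ρ (brkL n (L i) (L j)) x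
        * metric n c ρ (brkL n (L i) (L j)) y) := hR
  have hA : ∀ x y, metric n c ρ (adHs.mulVec x) y = metric n c ρ (brkL n H y) x := by
    intro x y
    rw [metric_comm, ← adL_mulVec]
    exact (hadHs y x).symm
  change _ = ricci n c ρ
  set T := Rm - (1/2 : ℝ) • Bm - (1/2 : ℝ) • (adL n H + adHs) with hT
  have form : ∀ x y, metric n c ρ (T.mulVec x) y = metric n c ρ (Rm.mulVec x) y
      - 1/2 * metric n c ρ (Bm.mulVec x) y
      - 1/2 * (metric n c ρ (brkL n H x) y + metric n c ρ (adHs.mulVec x) y) := by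
    intro x y
    simp only [hT, sub_mulVec, smul_mulVec, add_mulVec, adL_mulVec, ← metricForm_apply, map_sub,
      map_smul, map_add, LinearMap.sub_apply, LinearMap.smul_apply, LinearMap.add_apply,
      smul_eq_mul]
  have key : ∀ x y, metric n c ρ (T.mulVec x) y = metric n c ρ ((ricci n c ρ).mulVec x) y := by
    refine eq_of_quadratic_eq (B := metricForm n c ρ ∘ₗ T.mulVecLin)
      (C := metricForm n c ρ ∘ₗ (ricci n c ρ).mulVecLin) (fun x y => ?_) (fun x y => ?_)
      (fun x => ?_)
    · change metric n c ρ (T.mulVec x) y = metric n c ρ (T.mulVec y) x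
      rw [form, form, hR', hR', hB', hB', hA, hA, Matrix.trace_mul_comm]
      simp only [metric_comm n c ρ (brkL n y _), mul_comm (metric n c ρ _ y)]
      ring
    · change metric n c ρ ((ricci n c ρ).mulVec x) y = metric n c ρ ((ricci n c ρ).mulVec y) x
      simp only [metric_ricci hc hρ, mul_comm (y _)]
      ring
    · change metric n c ρ (T.mulVec x) x = metric n c ρ ((ricci n c ρ).mulVec x) x
      have hHx : metric n c ρ (brkL n H x) x =
          -((2*n+2) * (ρ/(ρ+c)) * metric n c ρ (brkL n x (stdVec a)) x) := by
        rw [hH', brkL_swap, brkL_smul]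
        simp [metric]
      rw [form, hR', hB', hA, trace_adL_mul_adL, hHx, ← ricci_quadratic hc hρ,
        ← sum_metric_brkL_self hc hρ hL, ← sum_sum_metric_brkL_sq hc hρ hL]
      simp only [pow_two]
      ring
  refine Matrix.toLin'.injective (LinearMap.ext fun x => ?_)
  exact eq_of_forall_metric_eq hL (key x)
end

section
/- Let n ≥ 2, c ≥ 0 and ρ > 0, and let A := ad(B_1^R) ∈ End(𝔩) and A* its adjoint with respect to the inner product g_ρ^c. Then the commutator [A, A*] = A∘A* − A*∘A vanishes if and only if c = 0. In particular, for c > 0 the operator ad(B_1^R) is not normal with respect to g_ρ^c. -/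
open Matrix

lemma nth_single {m : ℕ} (j : Fin m) (k : ℕ) :
    nth (Pi.single j (1 : ℝ)) k = if k = (j : ℕ) then 1 else 0 := by
  unfold nth
  by_cases h : k < m
  · simp [h, Pi.single_apply, Fin.ext_iff]
  · have : k ≠ j := by omega
    simp [h, this]

/-- The entries of the matrix of `ad(B₁ᴿ)`. -/
lemma adL_single_zero_apply (n : ℕ) (i j : Fin (4*n+7)) :
    adL n (Pi.single 0 1) i j =
      if (i : ℕ) = 0 then 0
      else if (i : ℕ) = 1 then (if (j : ℕ) = 1 then 2 else 0)
      else if (i : ℕ) < 2*n+2 then (if (j : ℕ) = i then 1 else 0)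
      else if (i : ℕ) < 2*n+4 then (if (j : ℕ) = i + 2 then -1 else 0)
      else if (i : ℕ) < 2*n+6 then (if (j : ℕ) + 2 = i then -1 else 0)
      else 0 := by
  have h0 : ∀ k, nth (Pi.single (0 : Fin (4*n+7)) (1 : ℝ)) k = if k = 0 then 1 else 0 := by
    intro k
    rw [nth_single, Fin.val_zero]
  have h1 : ∀ k, nth (Pi.single j (1 : ℝ)) k = if k = (j : ℕ) then 1 else 0 := nth_single j
  have hi := i.isLt
  simp only [adL, brkL, Matrix.of_apply]
  simp only [h0, h1]
  by_cases c0 : (i : ℕ) = 0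
  · simp [c0]
  by_cases c1 : (i : ℕ) = 1
  · simp [c1, eq_comm]
  by_cases c2 : (i : ℕ) < 2*n+2
  · simp [c0, c1, c2, eq_comm]
  by_cases c3 : (i : ℕ) = 2*n+2
  · simp [c3, eq_comm]
    grind
  by_cases c4 : (i : ℕ) = 2*n+3
  · simp [c4, eq_comm]
    grind
  by_cases c5 : (i : ℕ) = 2*n+4
  · simp [c5, eq_comm]
    grind
  by_cases c6 : (i : ℕ) = 2*n+5
  · simp [c6, eq_comm]
    grind
  have a1 : ¬ (i : ℕ) < 2*n+4 := by omega
  have a2 : ¬ (i : ℕ) < 2*n+6 := by omega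
  by_cases c7 : (i : ℕ) = 4*n+6
  · simp [c0, c1, c2, c3, c4, c5, c6, a1, a2, if_pos c7]
  by_cases c8 : (i : ℕ) % 2 = 0
  · have b1 : (i : ℕ) - 2*n - 4 ≠ 0 := by omega
    have b2 : (i : ℕ) - 2*n - 3 ≠ 0 := by omega
    simp [c0, c1, c2, c3, c4, c5, c6, c7, c8, a1, a2, b1, b2]
  · have b1 : (i : ℕ) - 2*n - 4 ≠ 0 := by omega
    have b2 : (i : ℕ) - 2*n - 5 ≠ 0 := by omega
    simp [c0, c1, c2, c3, c4, c5, c6, c7, c8, a1, a2, b1, b2]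

/-- The adjoint identity `g(Ax, y) = g(x, A⋆y)` in terms of matrices. -/
lemma transpose_mul_eq_of_forall_dotProduct {m : Type*} [Fintype m] [DecidableEq m] {A B G : Matrix m m ℝ}
    (h : ∀ x y, A.mulVec x ⬝ᵥ G.mulVec y = x ⬝ᵥ G.mulVec (B.mulVec y)) : Aᵀ * G = G * B := by
  refine Matrix.ext_of_mulVec_single fun j => ?_
  refine dotProduct_eq _ _ fun x => ?_
  rw [dotProduct_comm _ x, dotProduct_comm _ x, ← Matrix.mulVec_mulVec, ← Matrix.mulVec_mulVec,
    ← h, Matrix.mulVec_transpose, dotProduct_comm, ← Matrix.dotProduct_mulVec, dotProduct_comm]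

lemma GramL_zero_eq_diagonal (n : ℕ) {ρ : ℝ} (hρ : 0 < ρ) :
    GramL n 0 ρ = Matrix.diagonal fun i : Fin (4*n+7) =>
      if (i : ℕ) < 2 then 1 else if (i : ℕ) < 2*n+2 then 1/4
      else if (i : ℕ) < 4*n+6 then 1/(4*ρ) else 1/(4*ρ^2) := by
  ext i j
  have hi := i.isLt
  simp only [GramL, Matrix.of_apply, Matrix.diagonal_apply]
  split_ifs <;> first | omega | (field_simp; done) | (field_simp; simp; done) | (field_simp; simp; ring)

/-- For `c = 0` the operator `ad(B₁ᴿ)` is self-adjoint. -/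
lemma adjoint_eq_self_of_zero (n : ℕ) {ρ : ℝ} (hρ : 0 < ρ)
    {B : Matrix (Fin (4*n+7)) (Fin (4*n+7)) ℝ}
    (hB : (adL n (Pi.single 0 1))ᵀ * GramL n 0 ρ = GramL n 0 ρ * B) :
    B = adL n (Pi.single 0 1) := by
  rw [GramL_zero_eq_diagonal n hρ] at hB
  ext i j
  have h := congrFun (congrFun hB i) j
  rw [Matrix.mul_diagonal, Matrix.diagonal_mul, Matrix.transpose_apply] at h
  set d : Fin (4*n+7) → ℝ := fun i =>
    if (i : ℕ) < 2 then 1 else if (i : ℕ) < 2*n+2 then 1/4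
      else if (i : ℕ) < 4*n+6 then 1/(4*ρ) else 1/(4*ρ^2) with hd
  have hpos : 0 < d i := by
    simp only [hd]
    split_ifs <;> positivity
  have hsymm : adL n (Pi.single 0 1) j i * d j = d i * adL n (Pi.single 0 1) i j := by
    by_cases hz : adL n (Pi.single 0 1) i j = 0 ∧ adL n (Pi.single 0 1) j i = 0
    · simp [hz.1, hz.2]
    · have hij : (i : ℕ) = j ∨ (2*n+2 ≤ (i : ℕ) ∧ (i : ℕ) < 2*n+6 ∧
          2*n+2 ≤ (j : ℕ) ∧ (j : ℕ) < 2*n+6) := by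
        by_contra hne
        apply hz
        simp only [adL_single_zero_apply]
        constructor <;> split_ifs <;> first | omega | rfl
      have hA : adL n (Pi.single 0 1) j i = adL n (Pi.single 0 1) i j ∧ d i = d j := by
        rcases hij with h' | ⟨h1, h2, h3, h4⟩
        · rw [Fin.ext h']
          exact ⟨rfl, rfl⟩
        · simp only [adL_single_zero_apply, hd]
          constructor <;> split_ifs <;> first | omega | rfl
      rw [hA.1, hA.2, mul_comm]
  exact mul_left_cancel₀ hpos.ne' (h.symm.trans hsymm)

lemma eq_zero_of_adL_commute (n : ℕ) {c ρ : ℝ} (hc : 0 ≤ c) (hρ : 0 < ρ)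
    {B : Matrix (Fin (4*n+7)) (Fin (4*n+7)) ℝ}
    (hB : (adL n (Pi.single 0 1))ᵀ * GramL n c ρ = GramL n c ρ * B)
    (hcomm : adL n (Pi.single 0 1) * B = B * adL n (Pi.single 0 1)) : c = 0 := by
  let p : Fin (4*n+7) := ⟨2*n+2, by omega⟩
  let q : Fin (4*n+7) := ⟨2*n+4, by omega⟩
  have hrow : ∀ k, adL n (Pi.single 0 1) p k = if k = q then -1 else 0 := fun k => by
    simp [adL_single_zero_apply, p, q, Fin.ext_iff]
  have hcol : ∀ k, adL n (Pi.single 0 1) k p = if k = q then -1 else 0 := fun k => by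
    rw [adL_single_zero_apply]
    simp only [p, q, Fin.ext_iff]
    grind
  have hcol' : ∀ k, adL n (Pi.single 0 1) k q = if k = p then -1 else 0 := fun k => by
    rw [adL_single_zero_apply]
    simp only [p, q, Fin.ext_iff]
    grind
  have hGp : ∀ k, GramL n c ρ p k = if k = p then (ρ+2*c)/(4*ρ^2) else 0 := fun k => by
    simp only [GramL, Matrix.of_apply, p, Fin.ext_iff]
    grind
  have hGq : ∀ k, GramL n c ρ q k = if k = q then 1/(4*ρ) else 0 := fun k => by
    simp only [GramL, Matrix.of_apply, q, Fin.ext_iff]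
    grind
  have e1 := congrFun (congrFun hB q) p
  have e2 := congrFun (congrFun hB p) q
  have e3 := congrFun (congrFun hcomm p) p
  simp [Matrix.mul_apply, hrow, hcol, hcol', hGp, hGq] at e1 e2 e3
  rw [e3] at e1
  have hne : B p q ≠ 0 := by
    intro h0
    rw [h0] at e1
    have : 0 < (ρ+2*c)/(4*ρ^2) := by positivity
    simp at e1
    rcases e1 with h | h
    · linarith
    · exact hρ.ne' h
  field_simp at e1 e2
  have hsq : (ρ+2*c)^2 = ρ^2 := by
    apply mul_right_cancel₀ hne
    linear_combination ρ*e1 - (ρ+2*c)*e2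
  nlinarith

/-- for paper `n ≥ 2` (our `n+2`), `c ≥ 0`, `ρ > 0`, let
`A := ad(B₁ᴿ)` (in the ordered basis `𝓑`, where `B₁ᴿ` is the first basis vector,
with coordinate vector `Pi.single 0 1`) and let `Astar` be its adjoint with respect to
`g_ρ^c`.  Then `[A, Astar] = A∘Astar - Astar∘A = 0` if and only if `c = 0`; in
particular for `c > 0` the operator `ad(B₁ᴿ)` is not normal w.r.t. `g_ρ^c`. -/
theorem statement15 (n : ℕ) (c ρ : ℝ) (hc : 0 ≤ c) (hρ : 0 < ρ)
    (Astar : Matrix (Fin (4*n+7)) (Fin (4*n+7)) ℝ)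
    (hAs : ∀ x y, ((adL n (Pi.single 0 1)).mulVec x) ⬝ᵥ (GramL n c ρ).mulVec y
      = x ⬝ᵥ (GramL n c ρ).mulVec (Astar.mulVec y)) :
    (adL n (Pi.single 0 1) * Astar - Astar * adL n (Pi.single 0 1) = 0 ↔ c = 0) ∧
    (0 < c → ¬ (adL n (Pi.single 0 1) * Astar = Astar * adL n (Pi.single 0 1))) := by
  have hB := transpose_mul_eq_of_forall_dotProduct hAs
  refine ⟨⟨fun h => eq_zero_of_adL_commute n hc hρ hB (sub_eq_zero.mp h), ?_⟩,
    fun hpos h => hpos.ne' (eq_zero_of_adL_commute n hc hρ hB h)⟩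
  rintro rfl
  rw [adjoint_eq_self_of_zero n hρ hB, sub_self]
end

section
/- Let n ≥ 2 and ρ > 0. The metric Lie algebra (𝔩, g_ρ^0) is a solvsoliton: its Ricci endomorphism satisfies ric(𝔩, g_ρ^0) = −2(n+2)·id + (2n+2)·δ, where δ is the derivation of 𝔩 given by δ(B) = 0 for B ∈ 𝔟, δ(e_k) = e_k, δ(f_k) = f_k, δ(Z) = 2Z. In particular there exist λ < 0 and a derivation D of 𝔩 with ric = λ·id + D. -/
open Matrix

/-- The derivation `δ` of `𝔩` (as a matrix in the ordered basis `𝓑`): `δ|_𝔟 = 0`,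
`δ(e_k) = e_k`, `δ(f_k) = f_k`, `δ(Z) = 2Z`. -/
noncomputable def deltaL (n : ℕ) : Matrix (Fin (4*n+7)) (Fin (4*n+7)) ℝ :=
  Matrix.of fun i j =>
    if i = j then
      (if (i:ℕ) < 2*n+2 then 0 else if (i:ℕ) < 4*n+6 then 1 else 2)
    else 0

/-- Labels for the ordered basis `𝓑`: `b0, b1` stand for `B₁ᴿ, B₁ᴵ`, `p t, q t` for `B_aᴿ, B_aᴵ`
and `u t, v t` for `e_a, f_a` with `a = t + 2`. -/
inductive BasisIdx (n : ℕ) : Type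
  | b0 | b1 | e0 | f0 | e1 | f1 | z
  | p (t : Fin n) | q (t : Fin n) | u (t : Fin n) | v (t : Fin n)
  deriving DecidableEq

namespace BasisIdx

variable {n : ℕ}

/-- The index of a basis vector in the ordered basis `𝓑`. -/
def toNat : BasisIdx n → ℕ
  | b0 => 0
  | b1 => 1
  | p t => 2 * t + 2
  | q t => 2 * t + 3
  | e0 => 2 * n + 2
  | f0 => 2 * n + 3
  | e1 => 2 * n + 4
  | f1 => 2 * n + 5
  | u t => 2 * n + 6 + 2 * t
  | v t => 2 * n + 7 + 2 * t
  | z => 4 * n + 6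

/-- The sum of a function over all basis vectors. -/
noncomputable def total (f : BasisIdx n → ℝ) : ℝ :=
  f b0 + f b1 + ∑ t, f (p t) + ∑ t, f (q t) + f e0 + f f0 + f e1 + f f1
    + ∑ t, f (u t) + ∑ t, f (v t) + f z

/-- The Lie bracket of `𝔩` in coordinates indexed by `BasisIdx`. -/
noncomputable def bracket (X Y : BasisIdx n → ℝ) : BasisIdx n → ℝ
  | b0 => 0
  | b1 => 2 * (X b0 * Y b1 - X b1 * Y b0)
      + (1 / 2) * ∑ t, (X (p t) * Y (q t) - X (q t) * Y (p t))
  | p t => X b0 * Y (p t) - X (p t) * Y b0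
  | q t => X b0 * Y (q t) - X (q t) * Y b0
  | e0 => -(X b0 * Y e1 - X e1 * Y b0) + (X b1 * (Y f0 + Y f1) - (X f0 + X f1) * Y b1)
      - (1 / 2) * ∑ t, (X (p t) * Y (u t) - X (u t) * Y (p t))
      + (1 / 2) * ∑ t, (X (q t) * Y (v t) - X (v t) * Y (q t))
  | f0 => -(X b0 * Y f1 - X f1 * Y b0) - (X b1 * (Y e0 + Y e1) - (X e0 + X e1) * Y b1)
      - (1 / 2) * ∑ t, (X (p t) * Y (v t) - X (v t) * Y (p t))
      - (1 / 2) * ∑ t, (X (q t) * Y (u t) - X (u t) * Y (q t))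
  | e1 => -(X b0 * Y e0 - X e0 * Y b0) - (X b1 * (Y f0 + Y f1) - (X f0 + X f1) * Y b1)
      + (1 / 2) * ∑ t, (X (p t) * Y (u t) - X (u t) * Y (p t))
      - (1 / 2) * ∑ t, (X (q t) * Y (v t) - X (v t) * Y (q t))
  | f1 => -(X b0 * Y f0 - X f0 * Y b0) + (X b1 * (Y e0 + Y e1) - (X e0 + X e1) * Y b1)
      + (1 / 2) * ∑ t, (X (p t) * Y (v t) - X (v t) * Y (p t))
      + (1 / 2) * ∑ t, (X (q t) * Y (u t) - X (u t) * Y (q t))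
  | z => (X e0 * Y f0 - X f0 * Y e0) - ((X e1 * Y f1 - X f1 * Y e1)
      + ∑ t, (X (u t) * Y (v t) - X (v t) * Y (u t)))
  | u t => -(1 / 2) * (X (p t) * (Y e0 + Y e1) - (X e0 + X e1) * Y (p t))
      - (1 / 2) * (X (q t) * (Y f0 + Y f1) - (X f0 + X f1) * Y (q t))
  | v t => -(1 / 2) * (X (p t) * (Y f0 + Y f1) - (X f0 + X f1) * Y (p t))
      + (1 / 2) * (X (q t) * (Y e0 + Y e1) - (X e0 + X e1) * Y (q t))

/-- The coordinates of a basis vector. -/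
noncomputable def unit (a : BasisIdx n) : BasisIdx n → ℝ := fun k => if k = a then 1 else 0

/-- The squared norms of the basis vectors with respect to `g_ρ^0`. -/
noncomputable def gram (ρ : ℝ) : BasisIdx n → ℝ
  | b0 => 1
  | b1 => 1
  | p _ => 1 / 4
  | q _ => 1 / 4
  | z => 1 / (4 * ρ ^ 2)
  | _ => 1 / (4 * ρ)

/-- The eigenvalues of `δ` on the basis vectors. -/
noncomputable def weight : BasisIdx n → ℝ
  | b0 => 0
  | b1 => 0
  | p _ => 0
  | q _ => 0
  | z => 2
  | _ => 1

lemma trace_ad (X : BasisIdx n → ℝ) :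
    total (fun a => bracket X (unit a) a) = (2 * n + 2) * X b0 := by
  simp [total, bracket, unit]
  ring

lemma killing_form (X Y : BasisIdx n → ℝ) :
    total (fun a => bracket X (bracket Y (unit a)) a) = (2 * n + 8) * (X b0 * Y b0) := by
  simp [total, bracket, unit]
  simp only [Finset.mul_sum, add_mul]
  ring_nf

lemma weight_bracket (X Y : BasisIdx n → ℝ) (k : BasisIdx n) :
    weight k * bracket X Y k = bracket (fun i => weight i * X i) Y k
      + bracket X (fun i => weight i * Y i) k := by
  cases k <;> simp [weight, bracket] <;> ring_nf

/-- The form `(X, Y) ↦ ∑ ⟨[X, L_i], [Y, L_i]⟩`. -/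
lemma ad_form {ρ : ℝ} (hρ : 0 < ρ) (X Y : BasisIdx n → ℝ) :
    total (fun a =>
      total (fun k => gram ρ k * (bracket X (unit a) k * bracket Y (unit a) k)) / gram ρ a) =
    (2 * n + 8) * (X b0 * Y b0) + 12 * (X b1 * Y b1)
      + 13 / 4 * (∑ t, X (p t) * Y (p t) + ∑ t, X (q t) * Y (q t))
      + 1 / (4 * ρ) * ((2 * n + 7) * (X e0 * Y e0 + X f0 * Y f0 + X e1 * Y e1 + X f1 * Y f1)
        + 2 * (n + 1) * (X e0 * Y e1 + X e1 * Y e0 + X f0 * Y f1 + X f1 * Y f0)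
        + 8 * (∑ t, X (u t) * Y (u t) + ∑ t, X (v t) * Y (v t))) := by
  simp [total, bracket, unit, gram, div_eq_mul_inv]
  ring_nf
  simp only [Finset.sum_add_distrib, ← Finset.sum_mul]
  simp only [mul_assoc, ← Finset.mul_sum]
  simp
  field_simp
  ring_nf

lemma neg_ite_zero (c : Prop) [Decidable c] (a : ℝ) :
    -(if c then a else 0) = if c then -a else 0 := by
  split_ifs <;> simp

set_option maxHeartbeats 2000000 in
/-- The form `(X, Y) ↦ ∑ ⟨[L_i, L_j], X⟩ ⟨[L_i, L_j], Y⟩`. -/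
lemma coad_form {ρ : ℝ} (hρ : 0 < ρ) (X Y : BasisIdx n → ℝ) :
    total (fun a => total (fun b =>
      total (fun k => gram ρ k * (bracket (unit a) (unit b) k * X k))
       * total (fun k => gram ρ k * (bracket (unit a) (unit b) k * Y k)) / gram ρ b) / gram ρ a) =
    (8 * n + 8) * (X b1 * Y b1)
      + 1 / 2 * (∑ t, X (p t) * Y (p t) + ∑ t, X (q t) * Y (q t))
      + 1 / (4 * ρ) * ((4 * n + 6) * (X e0 * Y e0 + X f0 * Y f0 + X e1 * Y e1 + X f1 * Y f1)
        - 4 * (n + 1) * (X e0 * Y e1 + X e1 * Y e0 + X f0 * Y f1 + X f1 * Y f0)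
        + 8 * (∑ t, X (u t) * Y (u t) + ∑ t, X (v t) * Y (v t)))
      + (8 * n + 16) / (4 * ρ ^ 2) * (X z * Y z) := by
  simp [total, bracket, unit, gram, div_eq_mul_inv]
  simp only [neg_ite_zero, ite_add_ite, add_zero, ite_mul, mul_ite, zero_mul, mul_zero]
  simp only [Finset.sum_ite_eq', Finset.mem_univ, if_true]
  ring_nf
  simp only [Finset.sum_add_distrib, ← Finset.sum_mul]
  simp only [mul_assoc, ← Finset.mul_sum]
  simp
  field_simp
  ring_nf

/-- The bilinear form of the Ricci endomorphism of `(𝔩, g_ρ^0)`. -/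
lemma ricci_form {ρ : ℝ} (hρ : 0 < ρ) (X Y : BasisIdx n → ℝ) :
    -(1 / 2) * total (fun a =>
        total (fun k => gram ρ k * (bracket X (unit a) k * bracket Y (unit a) k)) / gram ρ a)
      + (1 / 4) * total (fun a => total (fun b =>
          total (fun k => gram ρ k * (bracket (unit a) (unit b) k * X k))
            * total (fun k => gram ρ k * (bracket (unit a) (unit b) k * Y k)) / gram ρ b)
          / gram ρ a)
      - (1 / 2) * total (fun a => bracket X (bracket Y (unit a)) a)
      - (1 / 2) * (total (fun k => gram ρ k * (bracket (fun i => (2 * n + 2) * unit b0 i) X k * Y k))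
        + total (fun k => gram ρ k * (bracket (fun i => (2 * n + 2) * unit b0 i) Y k * X k))) =
    total (fun k => gram ρ k * ((-2 * (n + 4) * X k + (2 * n + 6) * (weight k * X k)) * Y k)) := by
  rw [ad_form hρ, coad_form hρ, killing_form]
  have hp : ∑ t, Y (p t) * X (p t) = ∑ t, X (p t) * Y (p t) := by simp only [mul_comm]
  have hq : ∑ t, Y (q t) * X (q t) = ∑ t, X (q t) * Y (q t) := by simp only [mul_comm]
  simp [total, bracket, unit, gram, weight, div_eq_mul_inv]
  ring_nf
  simp only [Finset.sum_add_distrib, ← Finset.sum_mul]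
  simp only [mul_assoc, ← Finset.mul_sum]
  simp
  rw [hp, hq]
  field_simp
  ring_nf

lemma toNat_lt (a : BasisIdx n) : a.toNat < 4 * n + 7 := by
  cases a <;> simp only [toNat] <;> omega

/-- The position of a basis vector in the ordered basis, as an index of coordinates. -/
def pos (a : BasisIdx n) : Fin (4 * n + 7) := ⟨a.toNat, a.toNat_lt⟩

lemma pos_injective : Function.Injective (pos (n := n)) := by
  intro a b h
  have h' : a.toNat = b.toNat := congrArg Fin.val h
  cases a <;> cases b <;> simp only [toNat] at h' <;>
    first
    | rfl
    | omega
    | (congr 1; ext; omega)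

lemma pos_surjective : Function.Surjective (pos (n := n)) := by
  intro k
  obtain ⟨k, hk⟩ := k
  have key : ∃ a : BasisIdx n, a.toNat = k := by
    by_cases h0 : k = 0
    · exact ⟨b0, by simp [toNat, h0]⟩
    by_cases h1 : k = 1
    · exact ⟨b1, by simp [toNat, h1]⟩
    by_cases h2 : k < 2 * n + 2
    · rcases Nat.even_or_odd' k with ⟨t, ht | ht⟩
      · exact ⟨p ⟨t - 1, by omega⟩, by simp only [toNat]; omega⟩
      · exact ⟨q ⟨t - 1, by omega⟩, by simp only [toNat]; omega⟩
    by_cases h3 : k = 2 * n + 2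
    · exact ⟨e0, h3.symm⟩
    by_cases h4 : k = 2 * n + 3
    · exact ⟨f0, h4.symm⟩
    by_cases h5 : k = 2 * n + 4
    · exact ⟨e1, h5.symm⟩
    by_cases h6 : k = 2 * n + 5
    · exact ⟨f1, h6.symm⟩
    by_cases h7 : k = 4 * n + 6
    · exact ⟨z, h7.symm⟩
    rcases Nat.even_or_odd' k with ⟨t, ht | ht⟩
    · exact ⟨u ⟨t - n - 3, by omega⟩, by simp only [toNat]; omega⟩
    · exact ⟨v ⟨t - n - 3, by omega⟩, by simp only [toNat]; omega⟩
  obtain ⟨a, ha⟩ := key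
  exact ⟨a, Fin.ext ha⟩

lemma single_pos (a : BasisIdx n) :
    (fun k => (Pi.single (pos a) (1 : ℝ) : Fin (4 * n + 7) → ℝ) (pos k)) = unit a := by
  ext k
  simp [unit, Pi.single_apply, pos_injective.eq_iff]

lemma nth_toNat (x : Fin (4 * n + 7) → ℝ) (a : BasisIdx n) : nth x a.toNat = x (pos a) := by
  simp [nth, pos, toNat_lt]

lemma sum_range_two_mul (m : ℕ) (f : ℕ → ℝ) :
    ∑ k ∈ Finset.range (2 * m), f k = ∑ t : Fin m, f (2 * t) + ∑ t : Fin m, f (2 * t + 1) := by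
  rw [Fin.sum_univ_eq_sum_range (fun t => f (2 * t)),
    Fin.sum_univ_eq_sum_range (fun t => f (2 * t + 1))]
  induction m with
  | zero => simp
  | succ m ih =>
    rw [show 2 * (m + 1) = 2 * m + 1 + 1 by ring, Finset.sum_range_succ, Finset.sum_range_succ, ih,
      Finset.sum_range_succ, Finset.sum_range_succ]
    ring

lemma sum_eq_total (F : Fin (4 * n + 7) → ℝ) : ∑ k, F k = total (fun a => F (pos a)) := by
  have h1 : ∑ k, F k = ∑ k ∈ Finset.range (4 * n + 7), nth F k := by
    rw [← Fin.sum_univ_eq_sum_range]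
    simp [nth]
  rw [h1]
  simp only [total, ← nth_toNat, toNat]
  generalize nth F = f
  rw [show 4 * n + 7 = 2 + (2 * n + (4 + (2 * n + 1))) by ring, Finset.sum_range_add,
    Finset.sum_range_add, Finset.sum_range_add, Finset.sum_range_add, sum_range_two_mul,
    sum_range_two_mul]
  simp only [Finset.sum_range_succ, Finset.sum_range_zero]
  ring_nf

lemma brkL_pos (x y : Fin (4 * n + 7) → ℝ) (a : BasisIdx n) :
    brkL n x y (pos a) = bracket (fun k => x (pos k)) (fun k => y (pos k)) a := by
  have hp : ((pos a : Fin (4 * n + 7)) : ℕ) = a.toNat := rfl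
  simp only [brkL, hp]
  generalize hK : a.toNat = K
  cases a <;> simp only [toNat] at hK <;> simp only [bracket, ← nth_toNat, toNat]
  case u t =>
    have ht := t.isLt
    simp (disch := omega) only [if_pos, if_neg]
    rw [show K - 2 * n - 4 = 2 * t + 2 by omega, show K - 2 * n - 3 = 2 * t + 3 by omega]
  case v t =>
    have ht := t.isLt
    simp (disch := omega) only [if_neg]
    rw [show K - 2 * n - 5 = 2 * t + 2 by omega, show K - 2 * n - 4 = 2 * t + 3 by omega]
  case z =>
    simp (disch := omega) only [if_pos, if_neg]
    rw [Finset.sum_range_succ', add_comm (∑ _ ∈ _, _), Finset.sum_range]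
    ring_nf
  all_goals
    simp (disch := omega) only [if_pos, if_neg]
  all_goals
    simp only [Finset.sum_range, ← hK]

lemma gramL_zero (ρ : ℝ) :
    GramL n 0 ρ = Matrix.diagonal (fun i => GramL n 0 ρ i i) := by
  ext i j
  by_cases h : i = j
  · subst h; simp
  · rw [Matrix.diagonal_apply_ne _ h]
    simp [GramL, h]

lemma gramL_pos {ρ : ℝ} (hρ : 0 < ρ) (a : BasisIdx n) :
    GramL n 0 ρ (pos a) (pos a) = gram ρ a := by
  have hp : ((pos a : Fin (4 * n + 7)) : ℕ) = a.toNat := rfl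
  simp only [GramL, Matrix.of_apply, if_true, hp, add_zero, mul_zero]
  generalize hK : a.toNat = K
  cases a <;> simp only [toNat] at hK <;> simp only [gram]
  all_goals
    simp (disch := omega) only [if_pos, if_neg]
  all_goals field_simp

lemma deltaL_mulVec_pos (x : Fin (4 * n + 7) → ℝ) (a : BasisIdx n) :
    (deltaL n).mulVec x (pos a) = weight a * x (pos a) := by
  have h : deltaL n = Matrix.diagonal (fun i => deltaL n i i) := by
    ext i j
    by_cases h : i = j
    · subst h; simp
    · rw [Matrix.diagonal_apply_ne _ h]
      simp [deltaL, h]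
  rw [h, Matrix.mulVec_diagonal]
  congr 1
  have hp : ((pos a : Fin (4 * n + 7)) : ℕ) = a.toNat := rfl
  simp only [deltaL, Matrix.of_apply, if_true, hp]
  generalize hK : a.toNat = K
  cases a <;> simp only [toNat] at hK <;> simp only [weight]
  all_goals simp (disch := omega) only [if_pos, if_neg]

/-- The bracket of `𝔩` as a bilinear map. -/
noncomputable def brkBilin (n : ℕ) :
    (Fin (4 * n + 7) → ℝ) →ₗ[ℝ] (Fin (4 * n + 7) → ℝ) →ₗ[ℝ] (Fin (4 * n + 7) → ℝ) :=
  LinearMap.mk₂ ℝ (brkL n)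
    (fun x x' y => by
      ext k
      obtain ⟨a, rfl⟩ := pos_surjective k
      rw [Pi.add_apply, brkL_pos, brkL_pos, brkL_pos]
      cases a <;> simp only [bracket, Pi.add_apply, add_mul, mul_add, Finset.sum_add_distrib,
        Finset.sum_sub_distrib] <;> ring)
    (fun c x y => by
      ext k
      obtain ⟨a, rfl⟩ := pos_surjective k
      rw [Pi.smul_apply, brkL_pos, brkL_pos]
      cases a <;> simp only [bracket, Pi.smul_apply, smul_eq_mul, Finset.sum_sub_distrib,
        mul_assoc, ← Finset.mul_sum] <;> ring)
    (fun x y y' => by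
      ext k
      obtain ⟨a, rfl⟩ := pos_surjective k
      rw [Pi.add_apply, brkL_pos, brkL_pos, brkL_pos]
      cases a <;> simp only [bracket, Pi.add_apply, add_mul, mul_add, Finset.sum_add_distrib,
        Finset.sum_sub_distrib] <;> ring)
    (fun c x y => by
      ext k
      obtain ⟨a, rfl⟩ := pos_surjective k
      rw [Pi.smul_apply, brkL_pos, brkL_pos]
      cases a <;> simp only [bracket, Pi.smul_apply, smul_eq_mul, Finset.sum_sub_distrib,
        mul_left_comm _ c, ← Finset.mul_sum] <;> ring)

lemma brkBilin_apply (x y : Fin (4 * n + 7) → ℝ) : brkBilin n x y = brkL n x y := rfl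

lemma adL_mulVec (x y : Fin (4 * n + 7) → ℝ) : adL n x *ᵥ y = brkL n x y := by
  have h : adL n x = LinearMap.toMatrix' (brkBilin n x) := by
    ext i j
    simp [adL, LinearMap.toMatrix'_apply, brkBilin_apply]
  rw [h, LinearMap.toMatrix'_mulVec, brkBilin_apply]

lemma deltaL_brkL (x y : Fin (4 * n + 7) → ℝ) :
    deltaL n *ᵥ brkL n x y = brkL n (deltaL n *ᵥ x) y + brkL n x (deltaL n *ᵥ y) := by
  ext k
  obtain ⟨a, rfl⟩ := pos_surjective k
  simp only [Pi.add_apply, brkL_pos, deltaL_mulVec_pos, weight_bracket]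

lemma dotProduct_gramL {ρ : ℝ} (hρ : 0 < ρ) (x y : Fin (4 * n + 7) → ℝ) :
    x ⬝ᵥ GramL n 0 ρ *ᵥ y = total (fun a => gram ρ a * (x (pos a) * y (pos a))) := by
  rw [gramL_zero, dotProduct, sum_eq_total]
  congr 1
  ext a
  rw [mulVec_diagonal, gramL_pos hρ]
  ring

lemma gram_pos {ρ : ℝ} (hρ : 0 < ρ) (a : BasisIdx n) : 0 < gram ρ a := by
  cases a <;> simp only [gram] <;> positivity

lemma sum_mul_of_orthonormal {ι : Type*} [Fintype ι] [DecidableEq ι] {g : ι → ℝ}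
    (hg : ∀ a, g a ≠ 0) {L : ι → ι → ℝ}
    (hL : ∀ i j, L i ⬝ᵥ diagonal g *ᵥ L j = if i = j then (1 : ℝ) else 0)
    (φ ψ : (ι → ℝ) →ₗ[ℝ] ℝ) :
    ∑ i, φ (L i) * ψ (L i) = ∑ a, φ (Pi.single a 1) * ψ (Pi.single a 1) / g a := by
  have h1 : of L * (diagonal g * (of L)ᵀ) = 1 := by
    ext i j
    rw [one_apply, ← hL i j, mul_apply, dotProduct]
    simp [mulVec_diagonal]
  have h2 : ∀ a b, ∑ i, L i a * L i b = if a = b then (g a)⁻¹ else 0 := by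
    intro a b
    have h0 := mul_eq_one_comm.mp h1
    have h := congrFun (congrFun h0 a) b
    rw [mul_apply, one_apply] at h
    simp only [diagonal_mul, transpose_apply, of_apply, mul_assoc, ← Finset.mul_sum] at h
    rw [eq_div_of_mul_eq (hg a) ((mul_comm _ _).trans h)]
    split_ifs <;> simp
  have h3 : ∀ (χ : (ι → ℝ) →ₗ[ℝ] ℝ) (v : ι → ℝ), χ v = ∑ a, v a * χ (Pi.single a 1) := by
    intro χ v
    rw [LinearMap.pi_apply_eq_sum_univ χ v]
    refine Finset.sum_congr rfl fun a _ => ?_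
    rw [smul_eq_mul]
    congr 2
    ext j
    simp [Pi.single_apply, eq_comm]
  calc ∑ i, φ (L i) * ψ (L i)
      = ∑ a, ∑ b, φ (Pi.single a 1) * ψ (Pi.single b 1) * ∑ i, L i a * L i b := by
        simp only [h3 φ (L _), h3 ψ (L _), Finset.sum_mul_sum]
        simp only [Finset.mul_sum]
        rw [Finset.sum_comm]
        refine Finset.sum_congr rfl fun a _ => ?_
        rw [Finset.sum_comm]
        refine Finset.sum_congr rfl fun b _ => Finset.sum_congr rfl fun i _ => ?_
        ring
    _ = _ := by simp [h2, div_eq_mul_inv]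

/-- The pairing with a fixed vector. -/
def dotLin {ι : Type*} [Fintype ι] (w : ι → ℝ) : (ι → ℝ) →ₗ[ℝ] ℝ where
  toFun v := v ⬝ᵥ w
  map_add' a b := add_dotProduct a b w
  map_smul' c a := smul_dotProduct c a w

lemma brkL_single_right (x : Fin (4 * n + 7) → ℝ) (a b : BasisIdx n) :
    brkL n x (Pi.single (pos a) 1) (pos b) = bracket (fun k => x (pos k)) (unit a) b := by
  rw [brkL_pos, single_pos]

lemma sum_brkL_right {ρ : ℝ} (hρ : 0 < ρ) {L : Fin (4 * n + 7) → Fin (4 * n + 7) → ℝ}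
    (hL : ∀ i j, L i ⬝ᵥ GramL n 0 ρ *ᵥ L j = if i = j then (1 : ℝ) else 0)
    (x y : Fin (4 * n + 7) → ℝ) :
    ∑ i, brkL n x (L i) ⬝ᵥ GramL n 0 ρ *ᵥ brkL n y (L i) =
      total (fun a => total (fun k => gram ρ k * (bracket (fun i => x (pos i)) (unit a) k
        * bracket (fun i => y (pos i)) (unit a) k)) / gram ρ a) := by
  have hg : ∀ k, GramL n 0 ρ k k ≠ 0 := by
    intro k
    obtain ⟨a, rfl⟩ := pos_surjective k
    rw [gramL_pos hρ]
    exact (gram_pos hρ a).ne'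
  rw [gramL_zero] at hL
  have key := fun k => sum_mul_of_orthonormal hg hL
    (LinearMap.proj k ∘ₗ brkBilin n x) (LinearMap.proj k ∘ₗ brkBilin n y)
  simp only [LinearMap.comp_apply, LinearMap.proj_apply, brkBilin_apply] at key
  calc _ = ∑ k, GramL n 0 ρ k k * ∑ i, brkL n x (L i) k * brkL n y (L i) k := by
        simp only [Finset.mul_sum]
        rw [Finset.sum_comm]
        refine Finset.sum_congr rfl fun i _ => ?_
        rw [gramL_zero, dotProduct]
        refine Finset.sum_congr rfl fun k _ => ?_
        rw [mulVec_diagonal, diagonal_apply_eq]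
        ring
    _ = ∑ a, (∑ k, GramL n 0 ρ k k * (brkL n x (Pi.single a 1) k * brkL n y (Pi.single a 1) k))
          / GramL n 0 ρ a a := by
        simp only [key, Finset.mul_sum, Finset.sum_div]
        rw [Finset.sum_comm]
        refine Finset.sum_congr rfl fun i _ => Finset.sum_congr rfl fun k _ => ?_
        ring
    _ = _ := by simp only [sum_eq_total, gramL_pos hρ, brkL_single_right]

lemma sum_brkL_brkL {ρ : ℝ} (hρ : 0 < ρ) {L : Fin (4 * n + 7) → Fin (4 * n + 7) → ℝ}
    (hL : ∀ i j, L i ⬝ᵥ GramL n 0 ρ *ᵥ L j = if i = j then (1 : ℝ) else 0)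
    (x y : Fin (4 * n + 7) → ℝ) :
    ∑ i, ∑ j, (brkL n (L i) (L j) ⬝ᵥ GramL n 0 ρ *ᵥ x) * (brkL n (L i) (L j) ⬝ᵥ GramL n 0 ρ *ᵥ y) =
      total (fun a => total (fun b =>
        total (fun k => gram ρ k * (bracket (unit a) (unit b) k * x (pos k)))
          * total (fun k => gram ρ k * (bracket (unit a) (unit b) k * y (pos k))) / gram ρ b)
        / gram ρ a) := by
  have hg : ∀ k, GramL n 0 ρ k k ≠ 0 := by
    intro k
    obtain ⟨a, rfl⟩ := pos_surjective k
    rw [gramL_pos hρ]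
    exact (gram_pos hρ a).ne'
  have hL' := hL
  rw [gramL_zero] at hL'
  have right := fun v => sum_mul_of_orthonormal hg hL'
    (dotLin (GramL n 0 ρ *ᵥ x) ∘ₗ brkBilin n v) (dotLin (GramL n 0 ρ *ᵥ y) ∘ₗ brkBilin n v)
  have left := fun v => sum_mul_of_orthonormal hg hL'
    (dotLin (GramL n 0 ρ *ᵥ x) ∘ₗ (brkBilin n).flip v)
    (dotLin (GramL n 0 ρ *ᵥ y) ∘ₗ (brkBilin n).flip v)
  simp only [LinearMap.comp_apply, LinearMap.flip_apply, dotLin, LinearMap.coe_mk, AddHom.coe_mk,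
    brkBilin_apply] at left right
  calc _ = ∑ a, (∑ b,
          (brkL n (Pi.single a 1) (Pi.single b 1) ⬝ᵥ GramL n 0 ρ *ᵥ x)
            * (brkL n (Pi.single a 1) (Pi.single b 1) ⬝ᵥ GramL n 0 ρ *ᵥ y) / GramL n 0 ρ b b)
          / GramL n 0 ρ a a := by
        simp only [right]
        rw [Finset.sum_comm]
        simp only [← Finset.sum_div, left]
        simp only [Finset.sum_div]
        rw [Finset.sum_comm]
        exact Finset.sum_congr rfl fun a _ => Finset.sum_congr rfl fun b _ => div_right_comm _ _ _
    _ = _ := by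
        simp only [sum_eq_total, gramL_pos hρ, dotProduct_gramL hρ, brkL_single_right, single_pos]

lemma trace_adL (x : Fin (4 * n + 7) → ℝ) : (adL n x).trace = (2 * n + 2) * x (pos b0) := by
  rw [trace, sum_eq_total]
  simp only [diag_apply, adL, of_apply, brkL_single_right, trace_ad]

lemma trace_adL_mul_adL (x y : Fin (4 * n + 7) → ℝ) :
    (adL n x * adL n y).trace =
      total (fun a => bracket (fun i => x (pos i)) (bracket (fun i => y (pos i)) (unit a)) a) := by
  rw [trace, sum_eq_total]
  congr 1
  ext a
  have h : (adL n x * adL n y) *ᵥ Pi.single (pos a) 1 =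
      brkL n x (brkL n y (Pi.single (pos a) 1)) := by
    rw [← mulVec_mulVec, adL_mulVec, adL_mulVec]
  have h' := congrFun h (pos a)
  rw [mulVec_single_one] at h'
  rw [diag_apply]
  refine h'.trans ?_
  simp only [brkL_pos, single_pos]

lemma ext_of_dotProduct_gramL {ρ : ℝ} (hρ : 0 < ρ)
    {M N : Matrix (Fin (4 * n + 7)) (Fin (4 * n + 7)) ℝ}
    (h : ∀ x y, M *ᵥ x ⬝ᵥ GramL n 0 ρ *ᵥ y = N *ᵥ x ⬝ᵥ GramL n 0 ρ *ᵥ y) : M = N := by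
  ext i j
  obtain ⟨a, rfl⟩ := pos_surjective i
  have h' := h (Pi.single j 1) (Pi.single (pos a) 1)
  rw [gramL_zero, diagonal_mulVec_single, dotProduct_single, dotProduct_single, mul_one,
    gramL_pos hρ] at h'
  simpa using mul_right_cancel₀ (gram_pos hρ a).ne' h'

lemma dotProduct_gramL_comm {ρ : ℝ} (hρ : 0 < ρ) (x y : Fin (4 * n + 7) → ℝ) :
    x ⬝ᵥ GramL n 0 ρ *ᵥ y = y ⬝ᵥ GramL n 0 ρ *ᵥ x := by
  simp only [dotProduct_gramL hρ, mul_comm]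

theorem ricci_eq (n : ℕ) (ρ : ℝ) (hρ : 0 < ρ)
    (L : Fin (4*n+7) → (Fin (4*n+7) → ℝ))
    (hL : ∀ i j, L i ⬝ᵥ (GramL n 0 ρ).mulVec (L j) = if i = j then (1:ℝ) else 0)
    (H : Fin (4*n+7) → ℝ)
    (hH : ∀ x, H ⬝ᵥ (GramL n 0 ρ).mulVec x = (adL n x).trace)
    (Bm : Matrix (Fin (4*n+7)) (Fin (4*n+7)) ℝ)
    (hB : ∀ x y, (Bm.mulVec x) ⬝ᵥ (GramL n 0 ρ).mulVec y = (adL n x * adL n y).trace)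
    (Rm : Matrix (Fin (4*n+7)) (Fin (4*n+7)) ℝ)
    (hR : ∀ x y, (Rm.mulVec x) ⬝ᵥ (GramL n 0 ρ).mulVec y =
      -(1/2) * (∑ i, (brkL n x (L i)) ⬝ᵥ (GramL n 0 ρ).mulVec (brkL n y (L i)))
      + (1/4) * (∑ i, ∑ j,
          ((brkL n (L i) (L j)) ⬝ᵥ (GramL n 0 ρ).mulVec x)
            * ((brkL n (L i) (L j)) ⬝ᵥ (GramL n 0 ρ).mulVec y)))
    (adHs : Matrix (Fin (4*n+7)) (Fin (4*n+7)) ℝ)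
    (hadHs : ∀ x y, ((adL n H).mulVec x) ⬝ᵥ (GramL n 0 ρ).mulVec y
      = x ⬝ᵥ (GramL n 0 ρ).mulVec (adHs.mulVec y)) :
    Rm - (1/2 : ℝ) • Bm - (1/2 : ℝ) • (adL n H + adHs)
      = (-2*((n:ℝ)+4)) • (1 : Matrix (Fin (4*n+7)) (Fin (4*n+7)) ℝ)
        + (2*(n:ℝ)+6) • deltaL n := by
  have hH' : (fun a => H (pos a)) = fun i => (2 * n + 2) * unit b0 i := by
    ext a
    have h := hH (Pi.single (pos a) 1)
    rw [trace_adL, gramL_zero, diagonal_mulVec_single, dotProduct_single, gramL_pos hρ,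
      mul_one] at h
    simp only [Pi.single_apply, pos_injective.eq_iff] at h
    rcases eq_or_ne a b0 with rfl | ha
    · simpa [unit, gram] using h
    · rw [if_neg (Ne.symm ha), mul_zero] at h
      simpa [unit, ha] using (mul_eq_zero.mp h).resolve_right (gram_pos hρ a).ne'
  refine ext_of_dotProduct_gramL hρ fun x y => ?_
  have hadj : adHs *ᵥ x ⬝ᵥ GramL n 0 ρ *ᵥ y = brkL n H y ⬝ᵥ GramL n 0 ρ *ᵥ x := by
    rw [dotProduct_gramL_comm hρ, ← hadHs, adL_mulVec]
  have hric := ricci_form hρ (fun a => x (pos a)) (fun a => y (pos a))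
  have hright : ((-2*((n:ℝ)+4)) • (1 : Matrix (Fin (4*n+7)) (Fin (4*n+7)) ℝ)
      + (2*(n:ℝ)+6) • deltaL n) *ᵥ x ⬝ᵥ GramL n 0 ρ *ᵥ y =
      total (fun k => gram ρ k * ((-2 * (n + 4) * x (pos k)
        + (2 * n + 6) * (weight k * x (pos k))) * y (pos k))) := by
    simp only [dotProduct_gramL hρ, add_mulVec, smul_mulVec, one_mulVec, Pi.add_apply,
      Pi.smul_apply, smul_eq_mul, deltaL_mulVec_pos]
  rw [hright, ← hric]
  simp only [sub_mulVec, add_mulVec, smul_mulVec, sub_dotProduct, add_dotProduct, smul_dotProduct,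
    smul_eq_mul, hR, hB, hadj, adL_mulVec, sum_brkL_right hρ hL, sum_brkL_brkL hρ hL,
    trace_adL_mul_adL]
  simp only [dotProduct_gramL hρ, brkL_pos, hH']

end BasisIdx

/-- for paper `n ≥ 2` (our `N = n+2`) and `ρ > 0`, the metric Lie
algebra `(𝔩, g_ρ^0)` is a solvsoliton: its Ricci endomorphism (transcribed through
matrices in the ordered basis `𝓑` via its defining data, as in the paper) satisfies
`ric = -2(N+2)·id + (2N+2)·δ`, where `δ` is the derivation of `𝔩` given by `δ|_𝔟 = 0`,
`δ(e_k) = e_k`, `δ(f_k) = f_k`, `δ(Z) = 2Z`.  In particular there exist `λ < 0` and a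
derivation `D` of `𝔩` with `ric = λ·id + D`. -/
theorem statement16 (n : ℕ) (ρ : ℝ) (hρ : 0 < ρ)
    (L : Fin (4*n+7) → (Fin (4*n+7) → ℝ))
    (hL : ∀ i j, L i ⬝ᵥ (GramL n 0 ρ).mulVec (L j) = if i = j then (1:ℝ) else 0)
    (H : Fin (4*n+7) → ℝ)
    (hH : ∀ x, H ⬝ᵥ (GramL n 0 ρ).mulVec x = (adL n x).trace)
    (Bm : Matrix (Fin (4*n+7)) (Fin (4*n+7)) ℝ)
    (hB : ∀ x y, (Bm.mulVec x) ⬝ᵥ (GramL n 0 ρ).mulVec y = (adL n x * adL n y).trace)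
    (Rm : Matrix (Fin (4*n+7)) (Fin (4*n+7)) ℝ)
    (hR : ∀ x y, (Rm.mulVec x) ⬝ᵥ (GramL n 0 ρ).mulVec y =
      -(1/2) * (∑ i, (brkL n x (L i)) ⬝ᵥ (GramL n 0 ρ).mulVec (brkL n y (L i)))
      + (1/4) * (∑ i, ∑ j,
          ((brkL n (L i) (L j)) ⬝ᵥ (GramL n 0 ρ).mulVec x)
            * ((brkL n (L i) (L j)) ⬝ᵥ (GramL n 0 ρ).mulVec y)))
    (adHs : Matrix (Fin (4*n+7)) (Fin (4*n+7)) ℝ)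
    (hadHs : ∀ x y, ((adL n H).mulVec x) ⬝ᵥ (GramL n 0 ρ).mulVec y
      = x ⬝ᵥ (GramL n 0 ρ).mulVec (adHs.mulVec y)) :
    (∀ x y : Fin (4*n+7) → ℝ,
      (deltaL n).mulVec (brkL n x y)
        = brkL n ((deltaL n).mulVec x) y + brkL n x ((deltaL n).mulVec y)) ∧
    Rm - (1/2 : ℝ) • Bm - (1/2 : ℝ) • (adL n H + adHs)
      = (-2*((n:ℝ)+4)) • (1 : Matrix (Fin (4*n+7)) (Fin (4*n+7)) ℝ)
        + (2*(n:ℝ)+6) • deltaL n ∧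
    (∃ lam : ℝ, lam < 0 ∧ ∃ D : Matrix (Fin (4*n+7)) (Fin (4*n+7)) ℝ,
      (∀ x y : Fin (4*n+7) → ℝ,
        D.mulVec (brkL n x y) = brkL n (D.mulVec x) y + brkL n x (D.mulVec y)) ∧
      Rm - (1/2 : ℝ) • Bm - (1/2 : ℝ) • (adL n H + adHs)
        = lam • (1 : Matrix (Fin (4*n+7)) (Fin (4*n+7)) ℝ) + D) := by
  have hric := BasisIdx.ricci_eq n ρ hρ L hL H hH Bm hB Rm hR adHs hadHs
  refine ⟨BasisIdx.deltaL_brkL, hric, -2 * ((n : ℝ) + 4), by linarith [n.cast_nonneg (α := ℝ)],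
    (2 * (n : ℝ) + 6) • deltaL n, fun x y => ?_, hric⟩
  simp only [smul_mulVec, BasisIdx.deltaL_brkL]
  simp only [← BasisIdx.brkBilin_apply, map_smul, LinearMap.smul_apply, smul_add]
end

section
/- Let n ≥ 2 be an integer and ρ > 0. If c > 0, then the four real numbers r₁, r₂, r₃, r₄ are pairwise distinct; if c = 0, then r₁ = −2(n+2), r₂ = 2n, and r₃ = r₄ = −2. -/
/-- let `n ≥ 2` be an integer, `ρ > 0`, `c ≥ 0`, and let
`r₁, r₂, r₃, r₄` be the principal Ricci curvatures of the one-loop deformed hypersurface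
metric.  If `c > 0` then `r₁, r₂, r₃, r₄` are pairwise distinct; if `c = 0` then
`r₁ = -2(n+2)`, `r₂ = 2n` and `r₃ = r₄ = -2`. -/
theorem statement18 (n : ℕ) (hn : 2 ≤ n) (ρ c : ℝ) (hρ : 0 < ρ) (hc : 0 ≤ c)
    (r₁ r₂ r₃ r₄ : ℝ)
    (h1 : r₁ = (-2*((n:ℝ)+2)*ρ^2 - 4*((n:ℝ)+2)*c*ρ - 6*c^2)/((ρ+c)*(ρ+2*c)))
    (h2 : r₂ = (2*(n:ℝ)*ρ^4 + (12*(n:ℝ)-8)*c*ρ^3 + (28*(n:ℝ)-26)*c^2*ρ^2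
      + 32*((n:ℝ)-1)*c^3*ρ + 16*((n:ℝ)-1)*c^4)/((ρ+c)*(ρ+2*c)^3))
    (h3 : r₃ = 2*(-ρ^3 + (2*(n:ℝ)-3)*c*ρ^2 + 8*((n:ℝ)-1)*c^2*ρ + 8*((n:ℝ)-1)*c^3)/(ρ+2*c)^3)
    (h4 : r₄ = -2*(ρ+3*c)/(ρ+2*c)) :
    (0 < c → (r₁ ≠ r₂ ∧ r₁ ≠ r₃ ∧ r₁ ≠ r₄ ∧ r₂ ≠ r₃ ∧ r₂ ≠ r₄ ∧ r₃ ≠ r₄)) ∧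
    (c = 0 → (r₁ = -2*((n:ℝ)+2) ∧ r₂ = 2*(n:ℝ) ∧ r₃ = -2 ∧ r₄ = -2)) := by
  have hn' : (2 : ℝ) ≤ n := by exact_mod_cast hn
  refine ⟨fun hc' => ?_, ?_⟩
  · have h14 : r₁ < r₄ := by
      have key : r₄ - r₁ = ((2*(n:ℝ)+2)*ρ^2 + 4*n*c*ρ)/((ρ+c)*(ρ+2*c)) := by
        rw [h1, h4]
        field_simp
        ring
      refine sub_pos.mp ?_
      rw [key]
      positivity
    have h43 : r₄ < r₃ := by
      have key : r₃ - r₄ =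
          2*((2*(n:ℝ)+4)*c*ρ^2 + (8*n+8)*c^2*ρ + (8*n+4)*c^3)/(ρ+2*c)^3 := by
        rw [h3, h4]
        field_simp
        ring
      refine sub_pos.mp ?_
      rw [key]
      positivity
    have h32 : r₃ < r₂ := by
      have key : r₂ - r₃ = ((2*(n:ℝ)+2)*ρ^4 + 8*n*c*ρ^3 + (8*n-4)*c^2*ρ^2)
          /((ρ+c)*(ρ+2*c)^3) := by
        rw [h2, h3]
        field_simp
        ring
      have hcoef : 0 < 8*(n:ℝ)-4 := by linarith
      refine sub_pos.mp ?_
      rw [key]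
      positivity
    exact ⟨(h14.trans (h43.trans h32)).ne, (h14.trans h43).ne, h14.ne, h32.ne',
      (h43.trans h32).ne', h43.ne'⟩
  · rintro rfl
    refine ⟨?_, ?_, ?_, ?_⟩
    · rw [h1]
      field_simp
      ring
    · rw [h2]
      field_simp
      ring
    · rw [h3]
      field_simp
      ring
    · rw [h4]
      field_simp
      ring
end
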